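/- Assume F is tame with Disc F ⊆ {0}, and assume G has (at most) an isolated singular point at the origin, i.e., Sing G ⊆ {0} on V. Then the composition H = G ∘ F is tame. -/

import Mathlib

open Metric Set Function Topology

noncomputable section

/-- The singular set of a map: points where the total derivative is not surjective. -/
def Sing {E F : Type*} [NormedAddCommGroup E] [NormedSpace ℝ E] [NormedAddCommGroup F]
    [NormedSpace ℝ F] (P : E → F) : Set E :=
  {x | ¬ Function.Surjective ⇑(fderiv ℝ P x)}

/-- The Milnor set of a map (with respect to the Euclidean distance `‖x‖²`):
points where the derivative of `x ↦ (P x, ‖x‖²)` is not surjective. -/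
def MilnorSet {E F : Type*} [NormedAddCommGroup E] [NormedSpace ℝ E] [NormedAddCommGroup F]
    [NormedSpace ℝ F] (P : E → F) : Set E :=
  {x | ¬ Function.Surjective ⇑(fderiv ℝ (fun y => (P y, ‖y‖ ^ 2)) x)}

/-- Tameness: as set germs at the origin, `closure(M(P) \ Sing P) ∩ Sing P ⊆ {0}`. -/
def Tame {E F : Type*} [NormedAddCommGroup E] [NormedSpace ℝ E] [NormedAddCommGroup F]
    [NormedSpace ℝ F] (P : E → F) : Prop :=
  ∃ ε > 0, closure ((MilnorSet P \ Sing P) ∩ ball (0 : E) ε) ∩ Sing P ∩ ball (0 : E) ε ⊆ {0}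


set_option linter.all false

section part_a
open Module
section FC
variable {E : Type*} [NormedAddCommGroup E] [NormedSpace ℝ E] {m : ℕ} (β : Basis (Fin m) ℝ E)
  (p : FormalMultilinearSeries ℝ E ℝ) (C : Type*) [NormedRing C] [NormOneClass C] [NormedAlgebra ℝ C]

def fcSeries : FormalMultilinearSeries ℝ (Fin m → C) C := fun n =>
  ∑ i : Fin n → Fin m, p n (fun j => β (i j)) •
    (ContinuousMultilinearMap.mkPiAlgebraFin ℝ n C).compContinuousLinearMap
      (fun j => ContinuousLinearMap.proj (R := ℝ) (φ := fun _ : Fin m => C) (i j))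

lemma fcSeries_apply (n : ℕ) (c : Fin m → C) :
    fcSeries β p C n (fun _ => c) = ∑ i : Fin n → Fin m, p n (fun j => β (i j)) •
      (List.ofFn (fun j => c (i j))).prod := by
  simp [fcSeries]

lemma fcSeries_norm (b : ℝ) (hb : ∀ i, ‖β i‖ ≤ b) (n : ℕ) :
    ‖fcSeries β p C n‖ ≤ ‖p n‖ * (m * b) ^ n := by
  unfold fcSeries
  refine le_trans (norm_sum_le (E := ContinuousMultilinearMap ℝ (fun _ : Fin n => Fin m → C) C) _ _) ?_
  have : ∀ i ∈ (Finset.univ : Finset (Fin n → Fin m)), ‖p n (fun j => β (i j)) •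
    (ContinuousMultilinearMap.mkPiAlgebraFin ℝ n C).compContinuousLinearMap
      (fun j => ContinuousLinearMap.proj (R := ℝ) (φ := fun _ : Fin m => C) (i j))‖ ≤ ‖p n‖ * b ^ n := by
    intro i _
    refine le_trans (ContinuousMultilinearMap.opNorm_smul_le _ _) ?_
    have h1 : ‖p n (fun j => β (i j))‖ ≤ ‖p n‖ * b ^ n := by
      refine ((p n).le_opNorm _).trans ?_
      gcongr
      calc ∏ j, ‖β (i j)‖ ≤ ∏ j : Fin n, b := Finset.prod_le_prod (fun _ _ => norm_nonneg _) (fun j _ => hb _)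
        _ = b ^ n := by simp
    have h2 : ‖(ContinuousMultilinearMap.mkPiAlgebraFin ℝ n C).compContinuousLinearMap
      (fun j => ContinuousLinearMap.proj (R := ℝ) (φ := fun _ : Fin m => C) (i j))‖ ≤ 1 := by
      refine (ContinuousMultilinearMap.norm_compContinuousLinearMap_le _ _).trans ?_
      rw [ContinuousMultilinearMap.norm_mkPiAlgebraFin, one_mul]
      refine Finset.prod_le_one (fun _ _ => norm_nonneg _) (fun j _ => ?_)
      refine ContinuousLinearMap.opNorm_le_bound _ zero_le_one (fun x => ?_)
      simpa using norm_le_pi_norm x (i j)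
    have hb0 := (norm_nonneg _).trans h1
    calc _ ≤ (‖p n‖ * b ^ n) * 1 := by gcongr
      _ = _ := by ring
  refine (Finset.sum_le_sum this).trans (le_of_eq ?_)
  simp [mul_pow]; ring

lemma fcSeries_radius_pos (hp : 0 < p.radius) : 0 < (fcSeries β p C).radius := by
  obtain ⟨r, hr0, hr⟩ := ENNReal.lt_iff_exists_nnreal_btwn.1 hp
  have hr0' : 0 < r := by simpa using hr0
  obtain ⟨A, hA, hpA⟩ := FormalMultilinearSeries.norm_le_div_pow_of_pos_of_lt_radius p hr0' hr
  obtain ⟨b, hb0, hb⟩ : ∃ b : ℝ, 0 ≤ b ∧ ∀ i, ‖β i‖ ≤ b :=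
    ⟨∑ i, ‖β i‖, by positivity, fun i => Finset.single_le_sum (f := fun i => ‖β i‖) (fun _ _ => norm_nonneg _) (Finset.mem_univ i)⟩
  let s : ℝ := r / (m * b + 1)
  have hs : 0 < s := by have : (0:ℝ) < r := hr0'; positivity
  have : ((Real.toNNReal s : NNReal) : ENNReal) ≤ (fcSeries β p C).radius := by
    refine FormalMultilinearSeries.le_radius_of_bound _ A (fun n => ?_)
    rw [Real.coe_toNNReal s hs.le]
    have h1 := fcSeries_norm β p C b hb n
    have h2 := hpA n
    have hrp : (0:ℝ) < r := hr0'
    calc ‖fcSeries β p C n‖ * s ^ n ≤ ((A / r ^ n) * (m * b) ^ n) * s ^ n := by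
          refine mul_le_mul_of_nonneg_right (h1.trans ?_) (by positivity)
          gcongr
      _ ≤ ((A / r ^ n) * (m * b + 1) ^ n) * s ^ n := by
          gcongr; linarith
      _ = A := by
          simp only [s, div_pow]; field_simp
  refine lt_of_lt_of_le ?_ this
  simpa using hs

variable {C}

lemma fc_prod {n : ℕ} (i : Fin n → Fin m) (c : Fin m → C) (ψ : C →L[ℝ] ℝ) (z : Fin m → ℝ)
    (h : ∀ i a, ψ (c i * a) = z i * ψ a) :
    ψ (List.ofFn (fun j => c (i j))).prod = (∏ j, z (i j)) * ψ 1 := by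
  induction n with
  | zero => simp
  | succ n ih =>
    rw [List.ofFn_succ, List.prod_cons, h, ih (fun j => i j.succ), Fin.prod_univ_succ, mul_assoc]

lemma expand_p (n : ℕ) (z : E) :
    p n (fun _ => z) = ∑ i : Fin n → Fin m, (∏ j, β.repr z (i j)) * p n (fun j => β (i j)) := by
  have : (fun _ : Fin n => z) = fun _ => ∑ k, β.repr z k • β k := by
    funext; exact (β.sum_repr z).symm
  rw [this, ContinuousMultilinearMap.map_sum]
  refine Finset.sum_congr rfl (fun i _ => ?_)
  rw [ContinuousMultilinearMap.map_smul_univ]; simp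

variable [CompleteSpace C]

lemma fc_hasSum (c : Fin m → C) (hc : c ∈ Metric.eball (0 : Fin m → C) (fcSeries β p C).radius) :
    HasSum (fun n => fcSeries β p C n (fun _ => c)) ((fcSeries β p C).sum c) :=
  (fcSeries β p C).hasSum hc

lemma fc_eval (c : Fin m → C) (hc : c ∈ Metric.eball (0 : Fin m → C) (fcSeries β p C).radius)
    (ψ : C →L[ℝ] ℝ) (z : E) (h : ∀ i a, ψ (c i * a) = β.repr z i * ψ a) (y : ℝ)
    (hy : HasSum (fun n => p n (fun _ => z)) y) :
    ψ ((fcSeries β p C).sum c) = y * ψ 1 := by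
  have h1 := (fc_hasSum β p c hc).mapL ψ
  have h2 := hy.mul_right (ψ 1)
  refine h1.unique ?_
  have h3 : (fun n => ψ (fcSeries β p C n (fun _ => c))) = fun n => p n (fun _ => z) * ψ 1 := by
   funext n
   rw [fcSeries_apply, map_sum, expand_p β, Finset.sum_mul]
   refine Finset.sum_congr rfl (fun i _ => ?_)
   rw [map_smul, fc_prod i c ψ (fun i => β.repr z i) h]; simp; ring
  rw [h3]; exact h2

lemma fc_line (e : E) (S : C) (n : ℕ) :
    fcSeries β p C n (fun _ => fun i => β.repr e i • S) = p n (fun _ => e) • S ^ n := by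
  rw [fcSeries_apply, expand_p β, Finset.sum_smul]
  refine Finset.sum_congr rfl (fun i _ => ?_)
  have : ∀ {n : ℕ} (w : Fin n → ℝ), (List.ofFn (fun j => w j • S)).prod = (∏ j, w j) • S ^ n := by
    intro n w
    induction n with
    | zero => simp
    | succ n ih =>
      rw [List.ofFn_succ, List.prod_cons, ih (fun j => w j.succ), Fin.prod_univ_succ, pow_succ']
      rw [smul_mul_smul_comm]
  rw [this, smul_smul, mul_comm]

lemma fc_analytic (hp : 0 < p.radius) : ∀ᶠ c in 𝓝 (0 : Fin m → C),
    AnalyticAt ℝ (fcSeries β p C).sum c ∧ c ∈ Metric.eball (0 : Fin m → C) (fcSeries β p C).radius := by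
  have h := (fcSeries β p C).hasFPowerSeriesOnBall (fcSeries_radius_pos β p C hp)
  exact h.analyticAt.eventually_analyticAt.and (Metric.eball_mem_nhds _ (fcSeries_radius_pos β p C hp))
end FC

end part_a

section part_b
open Module
open scoped BoundedContinuousFunction

lemma exists_shift : ∃ (S T : (ℕ →ᵇ ℝ) →L[ℝ] (ℕ →ᵇ ℝ)) (ε : (ℕ →ᵇ ℝ) →L[ℝ] ℝ) (e : ℕ →ᵇ ℝ),
    (∀ b, T (S b) = b) ∧ (∀ b, S (T b) + ε b • e = b) ∧ (∀ b, ε (S b) = 0) ∧ ε e = 1 := by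
  let S0 : (ℕ →ᵇ ℝ) →ₗ[ℝ] (ℕ →ᵇ ℝ) :=
    { toFun := fun b => BoundedContinuousFunction.ofNormedAddCommGroupDiscrete
        (fun n => Nat.casesOn n 0 (fun j => b j)) ‖b‖ (by
          intro n; cases n with
          | zero => simp
          | succ j => exact b.norm_coe_le_norm j)
      map_add' := by intro a b; ext n; cases n <;> simp
      map_smul' := by intro a b; ext n; cases n <;> simp }
  let T0 : (ℕ →ᵇ ℝ) →ₗ[ℝ] (ℕ →ᵇ ℝ) :=
    { toFun := fun b => BoundedContinuousFunction.ofNormedAddCommGroupDiscrete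
        (fun n => b (n+1)) ‖b‖ (by
          intro n; exact b.norm_coe_le_norm _)
      map_add' := by intro a b; ext n; simp
      map_smul' := by intro a b; ext n; simp }
  let S : (ℕ →ᵇ ℝ) →L[ℝ] (ℕ →ᵇ ℝ) := S0.mkContinuous 1 (by
    intro b; rw [one_mul]
    rw [BoundedContinuousFunction.norm_le (norm_nonneg _)]
    intro n
    cases n with
    | zero => simp [S0]
    | succ j => exact b.norm_coe_le_norm j)
  let T : (ℕ →ᵇ ℝ) →L[ℝ] (ℕ →ᵇ ℝ) := T0.mkContinuous 1 (by
    intro b; rw [one_mul]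
    rw [BoundedContinuousFunction.norm_le (norm_nonneg _)]
    intro n
    exact b.norm_coe_le_norm (n+1))
  refine ⟨S, T, BoundedContinuousFunction.evalCLM ℝ 0,
    BoundedContinuousFunction.ofNormedAddCommGroupDiscrete (fun n => if n = 0 then 1 else 0) 1 (by
      intro n; split_ifs <;> simp), ?_, ?_, ?_, ?_⟩
  · intro b; ext n; simp [S, T, S0, T0]
  · intro b; ext n; cases n <;> simp [S, T, S0, T0]
  · intro b; simp [S, S0]
  · simp

structure IsShift {B : Type*} [NormedAddCommGroup B] [NormedSpace ℝ B]
    (S T : B →L[ℝ] B) (ε : B →L[ℝ] ℝ) (e : B) : Prop where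
  ts : ∀ b, T (S b) = b
  st : ∀ b, S (T b) + ε b • e = b
  es : ∀ b, ε (S b) = 0
  ee : ε e = 1

section shift
variable {B : Type*} [NormedAddCommGroup B] [NormedSpace ℝ B]
    {S T : B →L[ℝ] B} {ε : B →L[ℝ] ℝ} {e : B}

lemma IsShift.smul (h : IsShift S T ε e) {σ : ℝ} (hσ : σ ≠ 0) : IsShift (σ • S) (σ⁻¹ • T) ε e where
  ts b := by simp [h.ts, hσ]
  st b := by simp [hσ, h.st]
  es b := by simp [h.es]
  ee := h.ee

lemma IsShift.te (h : IsShift S T ε e) : T e = 0 := by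
  have := h.st e
  rw [h.ee, one_smul] at this
  have h2 : S (T e) = 0 := by simpa using this
  rw [← h.ts (T e), h2, map_zero]

lemma IsShift.ev_S (h : IsShift S T ε e) {t : ℝ} (hu : IsUnit (1 - t • T)) (b : B) :
    ε (Ring.inverse (1 - t • T) (S b)) = t * ε (Ring.inverse (1 - t • T) b) := by
  set I := Ring.inverse (1 - t • T) with hI
  have h1 : ∀ x, I ((1 - t • T) x) = x := fun x =>
    congrArg (fun A : B →L[ℝ] B => A x) (Ring.inverse_mul_cancel _ hu)
  have h2 : ∀ x, (1 - t • T) (I x) = x := fun x =>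
    congrArg (fun A : B →L[ℝ] B => A x) (Ring.mul_inverse_cancel _ hu)
  have h3 : (1 - t • T) (S b + t • I b) = S b := by
    rw [map_add, map_smul, h2]; simp [h.ts]
  have h4 : I (S b) = S b + t • I b := by rw [← h1 (S b + t • I b), h3]
  rw [h4, map_add, h.es, map_smul]; simp

lemma IsShift.ev_e (h : IsShift S T ε e) {t : ℝ} (hu : IsUnit (1 - t • T)) :
    ε (Ring.inverse (1 - t • T) e) = 1 := by
  set I := Ring.inverse (1 - t • T) with hI
  have h1 : ∀ x, I ((1 - t • T) x) = x := fun x =>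
    congrArg (fun A : B →L[ℝ] B => A x) (Ring.inverse_mul_cancel _ hu)
  have h3 : (1 - t • T) e = e := by simp [h.te]
  rw [← h3, h1, h.ee]

lemma IsShift.ev_pow (h : IsShift S T ε e) {t : ℝ} (hu : IsUnit (1 - t • T)) (n : ℕ) :
    ε (Ring.inverse (1 - t • T) ((S ^ n) e)) = t ^ n := by
  induction n with
  | zero => simpa using h.ev_e hu
  | succ n ih =>
    rw [pow_succ', mul_apply_eq_comp, h.ev_S hu, ih, pow_succ']

lemma IsShift.tsn (h : IsShift S T ε e) (n : ℕ) (b : B) : (T ^ n) ((S ^ n) b) = b := by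
  induction n generalizing b with
  | zero => simp
  | succ n ih =>
    rw [pow_succ, pow_succ', mul_apply_eq_comp, mul_apply_eq_comp, h.ts, ih]

lemma IsShift.tse (h : IsShift S T ε e) (i k : ℕ) : (T ^ (i + (k + 1))) ((S ^ i) e) = 0 := by
  rw [add_comm, pow_add, mul_apply_eq_comp, h.tsn, pow_succ, mul_apply_eq_comp, h.te, map_zero]

lemma IsShift.decomp (h : IsShift S T ε e) (d : ℕ) (b : B) :
    (S ^ d) ((T ^ d) b) + ∑ i ∈ Finset.range d, ε ((T ^ i) b) • (S ^ i) e = b := by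
  induction d with
  | zero => simp
  | succ d ih =>
    rw [Finset.sum_range_succ]
    have h1 := congrArg (S ^ d) (h.st ((T ^ d) b))
    rw [map_add, map_smul] at h1
    rw [pow_succ S, pow_succ' T, mul_apply_eq_comp, mul_apply_eq_comp]
    conv_rhs => rw [← ih, ← h1]
    abel

/-- The operator `(b, r) ↦ S^d b + ∑ r_i S^i e` with a prefactor. -/
def divOp (S : B →L[ℝ] B) (e : B) (d : ℕ) (g : B →L[ℝ] B) : (B × (Fin d → ℝ)) →L[ℝ] B :=
  g.comp (ContinuousLinearMap.fst ℝ B (Fin d → ℝ)) +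
    (∑ i : Fin d, (ContinuousLinearMap.proj (R := ℝ) (φ := fun _ : Fin d => ℝ) i).smulRight ((S ^ (i : ℕ)) e)).comp
      (ContinuousLinearMap.snd ℝ B (Fin d → ℝ))

lemma divOp_apply (d : ℕ) (g : B →L[ℝ] B) (x : B × (Fin d → ℝ)) :
    divOp S e d g x = g x.1 + ∑ i : Fin d, x.2 i • (S ^ (i : ℕ)) e := by
  simp [divOp]

lemma IsShift.bij (h : IsShift S T ε e) (d : ℕ) (v : B →L[ℝ] B) (hv : IsUnit v) :
    Function.Bijective (divOp S e d (S ^ d * v)) := by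
  obtain ⟨v, rfl⟩ := hv
  constructor
  · rw [injective_iff_map_eq_zero]
    rintro ⟨b, r⟩ hb
    rw [divOp_apply] at hb
    simp only [mul_apply_eq_comp] at hb
    have h1 := congrArg (T ^ d) hb
    rw [map_add, h.tsn, map_sum, map_zero] at h1
    have h2 : ∀ i : Fin d, (T ^ d) (r i • (S ^ (i : ℕ)) e) = 0 := by
      intro i
      rw [map_smul]
      obtain ⟨k, hk⟩ := Nat.exists_eq_add_of_lt i.2
      have : (T ^ d) ((S ^ (i:ℕ)) e) = 0 := by
        have := h.tse i k
        rwa [← add_assoc, ← hk] at this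
      rw [this, smul_zero]
    rw [Finset.sum_congr rfl (fun i _ => h2 i), Finset.sum_const_zero, add_zero] at h1
    have hb0 : b = 0 := by
      have := congrArg (fun A : B →L[ℝ] B => A b) (Units.inv_mul v)
      simp only [mul_apply_eq_comp, h1, map_zero, one_apply_eq_self] at this
      exact this.symm
    rw [h1, map_zero, zero_add] at hb
    have hr : ∀ j : Fin d, r j = 0 := by
      intro j
      have h3 := congrArg (fun y => ε ((T ^ (j:ℕ)) y)) hb
      simp only [map_sum, map_smul, map_zero] at h3
      rw [Finset.sum_eq_single j] at h3
      · rw [h.tsn, h.ee] at h3; simpa using h3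
      · intro i _ hij
        rcases lt_or_gt_of_ne (fun hh => hij (Fin.ext hh) : (i:ℕ) ≠ j) with hlt | hlt
        · obtain ⟨k, hk⟩ := Nat.exists_eq_add_of_lt hlt
          have := h.tse i k
          rw [← add_assoc, ← hk] at this
          rw [this]; simp
        · obtain ⟨k, hk⟩ := Nat.exists_eq_add_of_lt hlt
          rw [hk, add_assoc, pow_add, mul_apply_eq_comp, h.tsn, pow_succ', mul_apply_eq_comp, h.es]
          simp
      · simp
    exact Prod.ext hb0 (funext hr)
  · intro y
    refine ⟨((↑v⁻¹ : B →L[ℝ] B) ((T ^ d) y), fun i => ε ((T ^ (i:ℕ)) y)), ?_⟩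
    rw [divOp_apply]
    have := congrArg (fun A : B →L[ℝ] B => A ((T ^ d) y)) (Units.mul_inv v)
    simp only [mul_apply_eq_comp, one_apply_eq_self] at this ⊢
    rw [this, Fin.sum_univ_eq_sum_range (fun i => ε ((T ^ i) y) • (S ^ i) e) d, h.decomp]
end shift

lemma tail_unit {C : Type*} [NormedRing C] [NormOneClass C] [NormedAlgebra ℝ C] [CompleteSpace C]
    (a : ℕ → ℝ) (A R : ℝ) (hA : 0 ≤ A) (hR : 0 < R) (ha : ∀ n, |a n| ≤ A * R ^ n) (h0 : a 0 ≠ 0) :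
    ∀ᶠ S in 𝓝 (0 : C), Summable (fun n => a n • S ^ n) ∧ IsUnit (∑' n, a n • S ^ n) := by
  have hb : ∀ n (S : C), S ∈ ball (0 : C) (1 / (2 * R)) → ‖a n • S ^ n‖ ≤ A * (1 / 2) ^ n := by
    intro n S hS
    have hS' : ‖S‖ ≤ 1 / (2 * R) := by simpa using (mem_ball_zero_iff.1 hS).le
    rw [norm_smul]
    calc ‖a n‖ * ‖S ^ n‖ ≤ (A * R ^ n) * (1 / (2 * R)) ^ n := by
          gcongr
          · exact ha n
          · exact (norm_pow_le S n).trans (by gcongr)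
      _ = A * (1 / 2) ^ n := by
          rw [mul_assoc, ← mul_pow]; congr 2; field_simp
  have hs : Summable (fun n : ℕ => A * (1 / 2 : ℝ) ^ n) := summable_geometric_two.mul_left A
  have hball : ball (0 : C) (1 / (2 * R)) ∈ 𝓝 (0 : C) := ball_mem_nhds _ (by positivity)
  have hc : ContinuousOn (fun S : C => ∑' n, a n • S ^ n) (ball (0 : C) (1 / (2 * R))) :=
    continuousOn_tsum (fun n => by fun_prop) hs hb
  have hc0 := hc.continuousAt hball
  have hu : IsUnit (∑' n, a n • (0 : C) ^ n) := by
    rw [tsum_eq_single 0 (by intro n hn; simp [hn])]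
    simpa using (IsUnit.mk0 _ h0).map (algebraMap ℝ C) |> fun h => by
      rwa [Algebra.algebraMap_eq_smul_one] at h
  filter_upwards [hball, hc0.eventually (Units.isOpen.mem_nhds hu)] with S h1 h2
  exact ⟨Summable.of_norm_bounded hs (fun n => hb n S h1), h2⟩

end part_b

section part_c
open Module
open scoped BoundedContinuousFunction

section division
variable {E E' : Type*} [NormedAddCommGroup E] [NormedSpace ℝ E] [FiniteDimensional ℝ E]
  [NormedAddCommGroup E'] [NormedSpace ℝ E']

lemma analyticAt_clm_apply {E X Y : Type*} [NormedAddCommGroup E] [NormedSpace ℝ E]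
    [NormedAddCommGroup X] [NormedSpace ℝ X] [NormedAddCommGroup Y] [NormedSpace ℝ Y]
    {f : E → X →L[ℝ] Y} {g : E → X} {x : E} (hf : AnalyticAt ℝ f x) (hg : AnalyticAt ℝ g x) :
    AnalyticAt ℝ (fun z => f z (g z)) x :=
  AnalyticAt.fun_comp (f := fun z => (f z, g z)) (g := fun p : (X →L[ℝ] Y) × X => p.1 p.2)
    (ContinuousLinearMap.analyticAt_bilinear (ContinuousLinearMap.id ℝ (X →L[ℝ] Y)) (f x, g x)) (hf.prod hg)

/-- the functional calculus `f(ι x + S e)` -/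
def fcAt {m : ℕ} (β : Basis (Fin m) ℝ E) (p : FormalMultilinearSeries ℝ E ℝ) {C : Type*}
    [NormedRing C] [NormedAlgebra ℝ C] (ι : E' →L[ℝ] E) (e : E) (S : C) (x : E') : C :=
  (fcSeries β p C).sum (fun i => (β.repr (ι x) i) • (1 : C) + β.repr e i • S)

lemma cmap_analytic {m : ℕ} (β : Basis (Fin m) ℝ E) {C : Type*}
    [NormedRing C] [NormedAlgebra ℝ C] (ι : E' →L[ℝ] E) (e : E) (S : C) (x : E') :
    AnalyticAt ℝ (fun x : E' => (fun i => (β.repr (ι x) i) • (1 : C) + β.repr e i • S)) x := by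
  rw [analyticAt_pi_iff]
  intro i
  refine AnalyticAt.add ?_ analyticAt_const
  have h : (fun x : E' => (β.repr (ι x) i) • (1 : C)) =
    fun x => (((LinearMap.toContinuousLinearMap (β.coord i)).comp ι).smulRight (1 : C)) x := by
    funext x; simp
  rw [h]
  exact ContinuousLinearMap.analyticAt _ _

variable {m : ℕ} (β : Basis (Fin m) ℝ E) (ι : E' →L[ℝ] E) (e : E)

lemma fcAt_analytic (p : FormalMultilinearSeries ℝ E ℝ) {C : Type*}
    [NormedRing C] [NormOneClass C] [NormedAlgebra ℝ C] (S : C)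
    (h : AnalyticAt ℝ (fcSeries β p C).sum (fun i => β.repr e i • S)) :
    AnalyticAt ℝ (fcAt β p ι e S) 0 := by
  refine AnalyticAt.fun_comp (g := (fcSeries β p C).sum)
    (f := fun x : E' => (fun i => (β.repr (ι x) i) • (1 : C) + β.repr e i • S)) ?_ (cmap_analytic β ι e S 0)
  simpa using h

lemma fcAt_eval {f : E → ℝ} {p : FormalMultilinearSeries ℝ E ℝ} (hp : HasFPowerSeriesAt f p 0)
    (π : E →L[ℝ] E') (τ : E →L[ℝ] ℝ) (hz : ∀ z, z = ι (π z) + τ z • e)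
    {B : Type*} [NormedAddCommGroup B] [NormedSpace ℝ B] [CompleteSpace B] [Nontrivial B]
    {S T : B →L[ℝ] B} {ε : B →L[ℝ] ℝ} {e0 : B} (hS : IsShift S T ε e0)
    (hc : (fun i => β.repr e i • S) ∈ Metric.eball (0 : Fin m → (B →L[ℝ] B)) (fcSeries β p (B →L[ℝ] B)).radius) :
    ∀ᶠ z in 𝓝 (0 : E), ∀ b, ε (Ring.inverse (1 - τ z • T) (fcAt β p ι e S (π z) b)) =
      f z * ε (Ring.inverse (1 - τ z • T) b) := by
  have hu : ∀ᶠ z in 𝓝 (0 : E), IsUnit (1 - τ z • T) := by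
    have : ContinuousAt (fun z : E => 1 - τ z • T) 0 := by fun_prop
    exact this.eventually (Units.isOpen.mem_nhds (by simp))
  have hball : ∀ᶠ z in 𝓝 (0 : E),
      (fun i => (β.repr (ι (π z)) i) • (1 : B →L[ℝ] B) + β.repr e i • S) ∈
      Metric.eball (0 : Fin m → (B →L[ℝ] B)) (fcSeries β p (B →L[ℝ] B)).radius := by
    have h1 := (cmap_analytic β ι e S (π 0)).continuousAt
    have h2 : ContinuousAt (fun z : E => (fun i => (β.repr (ι (π z)) i) • (1 : B →L[ℝ] B) + β.repr e i • S)) 0 :=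
      ContinuousAt.comp (f := π) h1 π.continuous.continuousAt
    refine h2.eventually (Metric.isOpen_eball.mem_nhds ?_)
    simpa using hc
  have hsum := hp.eventually_hasSum
  filter_upwards [hu, hball, hsum] with z hu hball hsum b
  rw [zero_add] at hsum
  let ψ : (B →L[ℝ] B) →L[ℝ] ℝ :=
    (ε.comp (Ring.inverse (1 - τ z • T))).comp (ContinuousLinearMap.apply ℝ B b)
  have := fc_eval β p _ hball ψ z (by
    intro i a
    have hz' : β.repr z i = β.repr (ι (π z)) i + τ z * β.repr e i := by
      conv_lhs => rw [hz z]
      simp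
    simp only [ψ, ContinuousLinearMap.comp_apply, ContinuousLinearMap.apply_apply, mul_apply_eq_comp,
      add_apply, smul_apply, one_apply_eq_self, map_add, map_smul, hS.ev_S hu, smul_eq_mul, hz']
    ring) (f z) hsum
  simpa [ψ, fcAt] using this

theorem weierstrass_division_aux {B : Type*} [NormedAddCommGroup B] [NormedSpace ℝ B] [CompleteSpace B] [Nontrivial B]
    {S1 T1 : B →L[ℝ] B} {ε : B →L[ℝ] ℝ} {e0 : B} (hS1 : IsShift S1 T1 ε e0) {f g : E → ℝ} (hf : AnalyticAt ℝ f 0)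
    {pg : FormalMultilinearSeries ℝ E ℝ} (hpg : HasFPowerSeriesAt g pg 0)
    (π : E →L[ℝ] E') (τ : E →L[ℝ] ℝ) (hz : ∀ z, z = ι (π z) + τ z • e)
    (d : ℕ) (hlt : ∀ n < d, pg n (fun _ => e) = 0) (hd : pg d (fun _ => e) ≠ 0) :
    ∃ q : E → ℝ, AnalyticAt ℝ q 0 ∧ ∃ r : Fin d → E' → ℝ, (∀ i, AnalyticAt ℝ (r i) 0) ∧
      ∀ᶠ z in 𝓝 (0 : E), f z = q z * g z + ∑ i, r i (π z) * (τ z) ^ (i : ℕ) := by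
  obtain ⟨pf, hpf⟩ := hf
  let β := finBasis ℝ E
  -- choice of scale
  have ht0 : Filter.Tendsto (fun σ : ℝ => σ • S1) (𝓝[≠] 0) (𝓝 0) := by
    have : Continuous (fun σ : ℝ => σ • S1) := by fun_prop
    simpa using (this.tendsto 0).mono_left nhdsWithin_le_nhds
  have htc : Filter.Tendsto (fun σ : ℝ => (fun i => β.repr e i • (σ • S1))) (𝓝[≠] 0) (𝓝 0) := by
    have : Continuous (fun σ : ℝ => (fun i => β.repr e i • (σ • S1))) := by fun_prop
    refine ((this.tendsto 0).mono_left nhdsWithin_le_nhds).trans (le_of_eq ?_)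
    congr 1; ext; simp
  have hpg0 : 0 < pg.radius := hpg.radius_pos
  obtain ⟨r, hr0, hr⟩ := ENNReal.lt_iff_exists_nnreal_btwn.1 hpg0
  have hr0' : 0 < r := by simpa using hr0
  obtain ⟨A, hA, hpA⟩ := FormalMultilinearSeries.norm_le_div_pow_of_pos_of_lt_radius pg hr0' hr
  have hrp : (0:ℝ) < r := hr0'
  let R : ℝ := (‖e‖ + 1) / r
  have hR : 0 < R := by positivity
  let a : ℕ → ℝ := fun n => pg n (fun _ => e)
  have ha : ∀ n, |a n| ≤ A * R ^ n := by
    intro n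
    refine ((pg n).le_opNorm _).trans ?_
    simp only [Finset.prod_const, Finset.card_univ, Fintype.card_fin]
    calc ‖pg n‖ * ‖e‖ ^ n ≤ (A / r ^ n) * (‖e‖ + 1) ^ n := by
          gcongr
          · exact hpA n
          · linarith
      _ = A * R ^ n := by simp only [R, div_pow]; ring
  have htail := tail_unit (C := B →L[ℝ] B) (fun n => a (n + d)) (A * R ^ d) R (by positivity) hR
    (fun n => (ha (n+d)).trans (le_of_eq (by rw [pow_add]; ring))) (by simpa [a] using hd)
  obtain ⟨σ, hσ0, ⟨hga, hgb⟩, ⟨hfa, hfb⟩, htsum, htu⟩ :=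
    ((show ∀ᶠ σ in 𝓝[≠] (0:ℝ), σ ≠ 0 from self_mem_nhdsWithin).and
    ((htc.eventually (fc_analytic β pg hpg.radius_pos)).and
    ((htc.eventually (fc_analytic β pf hpf.radius_pos)).and (ht0.eventually htail)))).exists
  set S := σ • S1 with hSdef
  have hS : IsShift S (σ⁻¹ • T1) ε e0 := hS1.smul hσ0
  set T := σ⁻¹ • T1
  -- value at zero
  let v : B →L[ℝ] B := ∑' n, a (n + d) • S ^ n
  have hg0 : fcAt β pg ι e S 0 = S ^ d * v := by
    have hh := (fc_hasSum β pg _ hgb)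
    simp only [fc_line] at hh
    have e1 : fcAt β pg ι e S 0 = (fcSeries β pg (B →L[ℝ] B)).sum (fun i => β.repr e i • S) := by
      simp [fcAt]
    rw [e1]
    refine hh.unique ?_
    have h5 : HasSum (fun n => S ^ d * (a (n + d) • S ^ n)) (S ^ d * v) := htsum.hasSum.mul_left _
    rw [← hasSum_nat_add_iff' d]
    rw [Finset.sum_eq_zero (fun i hi => by rw [hlt i (Finset.mem_range.1 hi), zero_smul]), sub_zero]
    have h6 : (fun n => pg (n+d) (fun _ => e) • S ^ (n+d)) = fun n => S ^ d * (a (n + d) • S ^ n) := by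
      funext n
      rw [mul_smul_comm, ← pow_add, add_comm d n]
    rw [h6]; exact h5
  have hbij := hS.bij d v htu
  rw [← hg0] at hbij
  let X := B × (Fin d → ℝ)
  let Λ : X ≃L[ℝ] B := ContinuousLinearEquiv.ofBijective (divOp S e0 d (fcAt β pg ι e S 0))
    (LinearMap.ker_eq_bot.2 hbij.1) (LinearMap.range_eq_top.2 hbij.2)
  have hΛ : (Λ : X →L[ℝ] B) = divOp S e0 d (fcAt β pg ι e S 0) := by
    exact ContinuousLinearMap.ext (fun x => rfl)
  let J : E' → (X →L[ℝ] X) := fun x => (Λ.symm : B →L[ℝ] X).comp (divOp S e0 d (fcAt β pg ι e S x))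
  have hgan : AnalyticAt ℝ (fcAt β pg ι e S) 0 := fcAt_analytic β ι e pg S hga
  have hfan : AnalyticAt ℝ (fcAt β pf ι e S) 0 := fcAt_analytic β ι e pf S hfa
  have hJan : AnalyticAt ℝ J 0 := by
    refine AnalyticAt.fun_comp (g := fun L : X →L[ℝ] B => (Λ.symm : B →L[ℝ] X).comp L)
      (((ContinuousLinearMap.compL ℝ X B X) (Λ.symm : B →L[ℝ] X)).analyticAt _) ?_
    refine AnalyticAt.add ?_ analyticAt_const
    exact AnalyticAt.fun_comp (g := fun L : B →L[ℝ] B => L.comp (ContinuousLinearMap.fst ℝ B (Fin d → ℝ)))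
      (((ContinuousLinearMap.compL ℝ X B B).flip (ContinuousLinearMap.fst ℝ B (Fin d → ℝ))).analyticAt _) hgan
  have hJ0 : J 0 = 1 := by
    simp only [J]; rw [← hΛ]; exact ContinuousLinearMap.ext (fun x => by simp)
  let sol : E' → X := fun x => Ring.inverse (J x) (Λ.symm (fcAt β pf ι e S x e0))
  have hinv : AnalyticAt ℝ (fun x => Ring.inverse (J x)) 0 := by
    refine AnalyticAt.fun_comp (g := Ring.inverse) ?_ hJan
    rw [hJ0]; exact analyticAt_inverse (1 : (X →L[ℝ] X)ˣ)
  have hsol : AnalyticAt ℝ sol 0 := by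
    refine analyticAt_clm_apply hinv ?_
    refine AnalyticAt.fun_comp (g := fun A : B →L[ℝ] B => (Λ.symm : B →L[ℝ] X) (A e0)) ?_ hfan
    exact ((Λ.symm : B →L[ℝ] X).comp (ContinuousLinearMap.apply ℝ B e0)).analyticAt _
  have hsol_eq : ∀ᶠ x in 𝓝 (0 : E'), divOp S e0 d (fcAt β pg ι e S x) (sol x) = fcAt β pf ι e S x e0 := by
    have : ∀ᶠ x in 𝓝 (0 : E'), IsUnit (J x) :=
      hJan.continuousAt.eventually (Units.isOpen.mem_nhds (by rw [hJ0]; exact isUnit_one))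
    filter_upwards [this] with x hx
    have h6 : J x (sol x) = Λ.symm (fcAt β pf ι e S x e0) :=
      congrArg (fun A : X →L[ℝ] X => A (Λ.symm (fcAt β pf ι e S x e0))) (Ring.mul_inverse_cancel _ hx)
    exact Λ.symm.injective h6
  have hπ0 : Filter.Tendsto π (𝓝 0) (𝓝 0) := by simpa using π.continuous.tendsto 0
  have hEv : AnalyticAt ℝ (fun z : E => Ring.inverse (1 - τ z • T)) 0 := by
    refine AnalyticAt.fun_comp (g := Ring.inverse) (f := fun z : E => 1 - τ z • T) ?_ ?_
    · simpa using analyticAt_inverse (𝕜 := ℝ) (1 : (B →L[ℝ] B)ˣ)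
    · exact analyticAt_const.sub ((τ.smulRight T).analyticAt 0)
  have hsolπ : AnalyticAt ℝ (fun z => sol (π z)) 0 :=
    AnalyticAt.fun_comp (by simpa using hsol) (π.analyticAt 0)
  refine ⟨fun z => ε (Ring.inverse (1 - τ z • T) (sol (π z)).1), ?_, fun i x => (sol x).2 i, ?_, ?_⟩
  · refine AnalyticAt.fun_comp (g := ε) (ε.analyticAt _) ?_
    refine analyticAt_clm_apply hEv ?_
    exact AnalyticAt.fun_comp ((ContinuousLinearMap.fst ℝ B (Fin d → ℝ)).analyticAt _) hsolπ
  · intro i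
    exact AnalyticAt.fun_comp (g := fun x : X => x.2 i)
      (((ContinuousLinearMap.proj (R := ℝ) (φ := fun _ : Fin d => ℝ) i).comp (ContinuousLinearMap.snd ℝ B (Fin d → ℝ))).analyticAt _) hsol
  · have hu : ∀ᶠ z in 𝓝 (0 : E), IsUnit (1 - τ z • T) := by
      have : ContinuousAt (fun z : E => 1 - τ z • T) 0 := by fun_prop
      exact this.eventually (Units.isOpen.mem_nhds (by simp))
    filter_upwards [hu, hπ0.eventually hsol_eq, fcAt_eval β ι e hpg π τ hz hS hgb, fcAt_eval β ι e hpf π τ hz hS hfb]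
      with z hu hs hg hf
    have h7 := congrArg (fun y => ε (Ring.inverse (1 - τ z • T) y)) hs
    simp only [divOp_apply, map_add, map_sum, map_smul, hg, hf, hS.ev_e hu, hS.ev_pow hu, smul_eq_mul, mul_one] at h7
    rw [← h7]; ring

theorem weierstrass_division {f g : E → ℝ} (hf : AnalyticAt ℝ f 0)
    {pg : FormalMultilinearSeries ℝ E ℝ} (hpg : HasFPowerSeriesAt g pg 0)
    (π : E →L[ℝ] E') (τ : E →L[ℝ] ℝ) (hz : ∀ z, z = ι (π z) + τ z • e)
    (d : ℕ) (hlt : ∀ n < d, pg n (fun _ => e) = 0) (hd : pg d (fun _ => e) ≠ 0) :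
    ∃ q : E → ℝ, AnalyticAt ℝ q 0 ∧ ∃ r : Fin d → E' → ℝ, (∀ i, AnalyticAt ℝ (r i) 0) ∧
      ∀ᶠ z in 𝓝 (0 : E), f z = q z * g z + ∑ i, r i (π z) * (τ z) ^ (i : ℕ) := by
  obtain ⟨S1, T1, ε, e0, h1, h2, h3, h4⟩ := exists_shift
  have hS1 : IsShift S1 T1 ε e0 := ⟨h1, h2, h3, h4⟩
  haveI : Nontrivial (ℕ →ᵇ ℝ) := ⟨e0, 0, by rintro rfl; simp at h4⟩
  exact weierstrass_division_aux ι e hS1 hf hpg π τ hz d hlt hd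

/-- Division statement without power series. -/
theorem weierstrass_div' {g : E → ℝ} (hg : AnalyticAt ℝ g 0)
    (hne : ¬ ∀ᶠ t in 𝓝 (0 : ℝ), g (t • e) = 0)
    (π : E →L[ℝ] E') (τ : E →L[ℝ] ℝ) (hz : ∀ z, z = ι (π z) + τ z • e) :
    ∃ d : ℕ, ∀ f : E → ℝ, AnalyticAt ℝ f 0 →
    ∃ q : E → ℝ, AnalyticAt ℝ q 0 ∧ ∃ r : Fin d → E' → ℝ, (∀ i, AnalyticAt ℝ (r i) 0) ∧
      ∀ᶠ z in 𝓝 (0 : E), f z = q z * g z + ∑ i, r i (π z) * (τ z) ^ (i : ℕ) := by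
  obtain ⟨pg, hpg⟩ := hg
  have hex : ∃ n, pg n (fun _ => e) ≠ 0 := by
    by_contra! hcon
    apply hne
    have ht : Filter.Tendsto (fun t : ℝ => t • e) (𝓝 0) (𝓝 0) := by
      have : Continuous (fun t : ℝ => t • e) := by fun_prop
      simpa using this.tendsto 0
    filter_upwards [ht.eventually hpg.eventually_hasSum] with t hts
    rw [zero_add] at hts
    have : (fun n => pg n (fun _ => t • e)) = fun _ => 0 := by
      funext n
      have := (pg n).map_smul_univ (fun _ => t) (fun _ => e)
      rw [this, hcon]; simp
    rw [this] at hts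
    exact hts.unique hasSum_zero
  classical
  exact ⟨Nat.find hex, fun f hf => weierstrass_division ι e hf hpg π τ hz _
    (fun n hn => by simpa using Nat.find_min hex hn) (Nat.find_spec hex)⟩
end division

end part_c

section part_d
open Module
section alg
open Polynomial
variable {A k K : Type*} [CommRing A] [Field k] [Field K] [Algebra k K] [CharZero k] (ψ : A →+* k)

lemma clear_denoms (hψ : ∀ x : k, ∃ a b, ψ b ≠ 0 ∧ x = ψ a / ψ b) (P : k[X]) : ∃ c : A, ψ c ≠ 0 ∧ ∃ Q : A[X], Q.map ψ = C (ψ c) * P := by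
  induction P using Polynomial.induction_on' with
  | add p q hp hq =>
    obtain ⟨c1, h1, Q1, e1⟩ := hp
    obtain ⟨c2, h2, Q2, e2⟩ := hq
    refine ⟨c1 * c2, by simp [h1, h2], C c2 * Q1 + C c1 * Q2, ?_⟩
    simp only [Polynomial.map_add, Polynomial.map_mul, map_C, e1, e2, map_mul]
    ring
  | monomial n x =>
    obtain ⟨a, b, hb, rfl⟩ := hψ x
    refine ⟨b, hb, monomial n a, ?_⟩
    rw [map_monomial, C_mul_monomial, mul_div_cancel₀ _ hb]

lemma algL1 (hψ : ∀ x : k, ∃ a b, ψ b ≠ 0 ∧ x = ψ a / ψ b)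
    {θ : K} (hθ : IsIntegral k θ) : ∃ Q : A[X],
    eval₂ ((algebraMap k K).comp ψ) θ Q = 0 ∧
    eval₂ ((algebraMap k K).comp ψ) θ (derivative Q) ≠ 0 ∧
    ∀ P : A[X], eval₂ ((algebraMap k K).comp ψ) θ P = 0 →
      ∃ c R, ψ c ≠ 0 ∧ (C c * P).map ψ = (Q * R).map ψ := by
  obtain ⟨c, hc, Q, hQ⟩ := clear_denoms ψ hψ (minpoly k θ)
  have key : ∀ P : A[X], eval₂ ((algebraMap k K).comp ψ) θ P = aeval θ (P.map ψ) := by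
    intro P
    rw [aeval_def, eval₂_map]
  have hc' : algebraMap k K (ψ c) ≠ 0 := by simpa using hc
  refine ⟨Q, ?_, ?_, ?_⟩
  · rw [key, hQ]; simp
  · rw [key, ← derivative_map, hQ, derivative_C_mul, map_mul, aeval_C]
    refine mul_ne_zero hc' ?_
    exact ((minpoly.irreducible hθ).separable).aeval_derivative_ne_zero (minpoly.aeval _ _)
  · intro P hP
    rw [key] at hP
    obtain ⟨ρ, hρ⟩ := minpoly.dvd k θ hP
    obtain ⟨c2, hc2, R, hR⟩ := clear_denoms ψ hψ ρ
    refine ⟨c * c2, R, by simp [hc, hc2], ?_⟩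
    simp only [Polynomial.map_mul, map_C, hQ, hR, hρ, map_mul]
    ring

lemma algL3 (hψ : ∀ x : k, ∃ a b, ψ b ≠ 0 ∧ x = ψ a / ψ b)
    {ξ : K} (hξ : IsIntegral k ξ) : ∃ (N : ℕ) (m : A[X]), m.natDegree ≤ N ∧ ψ (m.coeff N) ≠ 0 ∧
    eval₂ ((algebraMap k K).comp ψ) ξ m = 0 ∧
    ∀ P : A[X], P.natDegree ≤ N → eval₂ ((algebraMap k K).comp ψ) ξ P = 0 →
      ∀ i, ψ (m.coeff N) * ψ (P.coeff i) = ψ (P.coeff N) * ψ (m.coeff i) := by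
  obtain ⟨c, hc, Q, hQ⟩ := clear_denoms ψ hψ (minpoly k ξ)
  have key : ∀ P : A[X], eval₂ ((algebraMap k K).comp ψ) ξ P = aeval ξ (P.map ψ) := by
    intro P
    rw [aeval_def, eval₂_map]
  have hmon := minpoly.monic hξ
  obtain ⟨m, hm, hdeg⟩ := exists_degree_eq_of_mem_lifts (f := ψ) (p := Q.map ψ) ⟨Q, rfl⟩
  have hnd : m.natDegree = (minpoly k ξ).natDegree := by
    rw [natDegree_eq_of_degree_eq hdeg, hQ, natDegree_C_mul hc]
  have hco : ∀ i, ψ (m.coeff i) = ψ c * (minpoly k ξ).coeff i := by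
    intro i
    rw [← coeff_map, hm, hQ, coeff_C_mul]
  have hN : ψ (m.coeff (minpoly k ξ).natDegree) = ψ c := by
    rw [hco, hmon.coeff_natDegree, mul_one]
  refine ⟨(minpoly k ξ).natDegree, m, hnd.le, by rw [hN]; exact hc, ?_, ?_⟩
  · rw [key, hm, hQ]; simp
  · intro P hP h0 i
    rw [key] at h0
    rw [hN]
    have hz : P.map ψ - C (ψ (P.coeff (minpoly k ξ).natDegree)) * minpoly k ξ = 0 := by
      by_contra hne
      have h1 := minpoly.degree_le_of_ne_zero k ξ hne (by simp [h0])
      have h2 : (P.map ψ - C (ψ (P.coeff (minpoly k ξ).natDegree)) * minpoly k ξ).coeff (minpoly k ξ).natDegree = 0 := by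
        simp [hmon.coeff_natDegree]
      have h3 : (P.map ψ - C (ψ (P.coeff (minpoly k ξ).natDegree)) * minpoly k ξ).natDegree ≤ (minpoly k ξ).natDegree := by
        refine (natDegree_sub_le _ _).trans (max_le (natDegree_map_le.trans hP) (natDegree_C_mul_le _ _))
      have h4 := natDegree_le_natDegree h1
      have h5 := le_antisymm h3 h4
      rw [← h5] at h2
      exact hne (leadingCoeff_eq_zero.1 (by rw [h5] at h2; rw [leadingCoeff, h5]; exact h2))
    have h6 := congrArg (fun p => p.coeff i) hz
    simp only [coeff_sub, coeff_map, coeff_C_mul, coeff_zero, sub_eq_zero] at h6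
    rw [h6, hco]; ring

/-- evaluation in dual numbers -/
lemma algL2 {θ : K} {Q : A[X]} {Φ : A →+* DualNumber K}
    (hΦ : ∀ a, (Φ a).fst = algebraMap k K (ψ a)) (hΦ0 : ∀ a, ψ a = 0 → Φ a = 0)
    {y : DualNumber K} (hQ : eval₂ Φ y Q = 0)
    (hL1 : ∀ P : A[X], eval₂ ((algebraMap k K).comp ψ) θ P = 0 →
      ∃ c R, ψ c ≠ 0 ∧ (C c * P).map ψ = (Q * R).map ψ)
    (P : A[X]) (hP : eval₂ ((algebraMap k K).comp ψ) θ P = 0) : eval₂ Φ y P = 0 := by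
  obtain ⟨c, R, hc, h⟩ := hL1 P hP
  have h1 : eval₂ Φ y (C c * P - Q * R) = 0 := by
    rw [eval₂_eq_sum]
    refine Finset.sum_eq_zero (fun i _ => ?_)
    have : ψ ((C c * P - Q * R).coeff i) = 0 := by
      rw [← coeff_map, Polynomial.map_sub, h, sub_self, coeff_zero]
    beta_reduce
    rw [hΦ0 _ this, zero_mul]
  rw [eval₂_sub, eval₂_mul, eval₂_mul, hQ, zero_mul, sub_zero, eval₂_C] at h1
  have hu : IsUnit (Φ c) := by
    rw [TrivSqZeroExt.isUnit_iff_isUnit_fst, hΦ]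
    simpa using hc
  exact (hu.mul_right_eq_zero).1 h1

lemma dual_eval {Φ : A →+* DualNumber K} (θ n δ : K) (Q : A[X]) (D : A →+ K) (φ : A →+* K)
    (h1 : ∀ a, (Φ a).fst = φ a) (h2 : ∀ a, (Φ a).snd = δ * D a) :
    (eval₂ Φ (TrivSqZeroExt.inl θ + TrivSqZeroExt.inr n) Q).fst = eval₂ φ θ Q ∧
    (eval₂ Φ (TrivSqZeroExt.inl θ + TrivSqZeroExt.inr n) Q).snd =
      δ * (Q.sum fun i a => D a * θ ^ i) + n * eval₂ φ θ (derivative Q) := by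
  induction Q using Polynomial.induction_on' with
  | add p q hp hq =>
    rw [Polynomial.sum_add_index p q _ (by simp) (by intro i a b; rw [map_add, add_mul])]
    simp only [eval₂_add, TrivSqZeroExt.fst_add, TrivSqZeroExt.snd_add, hp, hq, derivative_add, true_and]
    ring
  | monomial i a =>
    rw [Polynomial.sum_monomial_index _ _ (by simp), derivative_monomial]
    simp only [eval₂_monomial, TrivSqZeroExt.fst_mul, TrivSqZeroExt.snd_mul, TrivSqZeroExt.fst_pow,
      TrivSqZeroExt.snd_pow, h1, h2, TrivSqZeroExt.fst_add, TrivSqZeroExt.snd_add, TrivSqZeroExt.fst_inl, TrivSqZeroExt.fst_inr, TrivSqZeroExt.snd_inl, TrivSqZeroExt.snd_inr, add_zero, zero_add, smul_eq_mul, map_mul, map_natCast,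
      MulOpposite.smul_eq_mul_unop, MulOpposite.unop_op, nsmul_eq_mul, Nat.pred_eq_sub_one, true_and]
    ring
end alg

end part_d

section part_e
open Module
/-- ring of functions analytic at 0 -/
def An (E : Type*) [NormedAddCommGroup E] [NormedSpace ℝ E] : Subring (E → ℝ) where
  carrier := {f | AnalyticAt ℝ f 0}
  mul_mem' hf hg := AnalyticAt.mul hf hg
  one_mem' := analyticAt_const
  add_mem' hf hg := AnalyticAt.add hf hg
  zero_mem' := analyticAt_const
  neg_mem' hf := AnalyticAt.neg hf

section
variable {E : Type*} [NormedAddCommGroup E] [NormedSpace ℝ E]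

abbrev GK (𝒰 : Ultrafilter E) : Type _ := Filter.Germ (𝒰 : Filter E) ℝ

/-- germ hom -/
def gφ (𝒰 : Ultrafilter E) : An E →+* GK 𝒰 where
  toFun f := ((f : E → ℝ) : GK 𝒰)
  map_one' := rfl
  map_zero' := rfl
  map_add' _ _ := rfl
  map_mul' _ _ := rfl

lemma gφ_eq {𝒰 : Ultrafilter E} {f g : An E} : gφ 𝒰 f = gφ 𝒰 g ↔ ∀ᶠ z in (𝒰 : Filter E), f.1 z = g.1 z :=
  Filter.Germ.coe_eq

lemma gφ_zero {𝒰 : Ultrafilter E} {f : An E} : gφ 𝒰 f = 0 ↔ ∀ᶠ z in (𝒰 : Filter E), f.1 z = 0 :=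
  Filter.Germ.coe_eq

/-- Lie derivative germ -/
def gD (𝒰 : Ultrafilter E) (v : E → E) (f : E → ℝ) : GK 𝒰 := ((fun z => fderiv ℝ f z (v z) : E → ℝ) : GK 𝒰)

lemma An_diff (f : An E) : ∀ᶠ z in 𝓝 (0 : E), DifferentiableAt ℝ f.1 z := by
  have h : AnalyticAt ℝ f.1 0 := f.2
  filter_upwards [h.eventually_analyticAt] with z hz using hz.differentiableAt

/-- Taylor hom -/
def gΦ (𝒰 : Ultrafilter E) (h : (𝒰 : Filter E) ≤ 𝓝 0) (v : E → E) : An E →+* DualNumber (GK 𝒰) where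
  toFun f := TrivSqZeroExt.inl (gφ 𝒰 f) + TrivSqZeroExt.inr (gD 𝒰 v f)
  map_one' := by
    ext
    · simp
    · simp only [gD, TrivSqZeroExt.snd_add, TrivSqZeroExt.snd_inl, TrivSqZeroExt.snd_inr, zero_add,
        TrivSqZeroExt.snd_one]
      refine Filter.Germ.coe_eq.2 (Filter.Eventually.of_forall fun z => ?_)
      have : ((1 : An E) : E → ℝ) = fun _ => 1 := rfl
      simp [this]
  map_zero' := by
    ext
    · simp
    · simp only [gD, TrivSqZeroExt.snd_add, TrivSqZeroExt.snd_inl, TrivSqZeroExt.snd_inr, zero_add,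
        TrivSqZeroExt.snd_zero]
      refine Filter.Germ.coe_eq.2 (Filter.Eventually.of_forall fun z => ?_)
      have : ((0 : An E) : E → ℝ) = fun _ => 0 := rfl
      simp [this]
  map_add' f g := by
    ext
    · simp
    · simp only [gD, TrivSqZeroExt.snd_add, TrivSqZeroExt.snd_inl, TrivSqZeroExt.snd_inr, zero_add]
      refine Filter.Germ.coe_eq.2 ?_
      filter_upwards [h (An_diff f), h (An_diff g)] with z hf hg
      have := fderiv_add hf hg
      exact congrArg (fun L : E →L[ℝ] ℝ => L (v z)) this
  map_mul' f g := by
    ext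
    · simp
    · simp only [gD, TrivSqZeroExt.snd_add, TrivSqZeroExt.snd_inl, TrivSqZeroExt.snd_inr, zero_add, TrivSqZeroExt.snd_mul,
        TrivSqZeroExt.fst_add, TrivSqZeroExt.fst_inl, TrivSqZeroExt.fst_inr, add_zero, smul_eq_mul, MulOpposite.smul_eq_mul_unop, MulOpposite.unop_op]
      refine Filter.Germ.coe_eq.2 ?_
      filter_upwards [h (An_diff f), h (An_diff g)] with z hf hg
      have := congrArg (fun L : E →L[ℝ] ℝ => L (v z)) (fderiv_mul hf hg)
      refine this.trans ?_
      simp [mul_comm]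

variable {𝒰 : Ultrafilter E} (h : (𝒰 : Filter E) ≤ 𝓝 0) (v : E → E) (f : An E)
@[simp] lemma gΦ_fst : (gΦ 𝒰 h v f).fst = gφ 𝒰 f := by simp [gΦ]
@[simp] lemma gΦ_snd : (gΦ 𝒰 h v f).snd = gD 𝒰 v f := by simp [gΦ]

/-- `gD` only depends on the germ at 0 -/
lemma gΦ_congr (f g : An E) (hfg : ∀ᶠ z in 𝓝 (0 : E), f.1 z = g.1 z) : gΦ 𝒰 h v f = gΦ 𝒰 h v g := by
  ext
  · rw [gΦ_fst, gΦ_fst]; exact gφ_eq.2 (h hfg)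
  · rw [gΦ_snd, gΦ_snd]
    refine Filter.Germ.coe_eq.2 ?_
    filter_upwards [h hfg.eventually_nhds] with z hz
    rw [Filter.EventuallyEq.fderiv_eq hz]

def Tangent (𝒰 : Ultrafilter E) (v : E → E) : Prop :=
  AnalyticAt ℝ v 0 ∧ ∀ f : An E, gφ 𝒰 f = 0 → gD 𝒰 v f = 0

/-- the key property -/
def KeyProp (E : Type*) [NormedAddCommGroup E] [NormedSpace ℝ E] : Prop :=
  ∀ 𝒰 : Ultrafilter E, (𝒰 : Filter E) ≤ 𝓝 0 → ∀ a b : An E, gφ 𝒰 b ≠ 0 →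
    (∀ v, Tangent 𝒰 v → gφ 𝒰 b * gD 𝒰 v a = gφ 𝒰 a * gD 𝒰 v b) →
    ∃ c : ℝ, ∀ᶠ z in (𝒰 : Filter E), a.1 z = c * b.1 z
end

end part_e

section part_f
open Module
section
variable {E : Type*} [NormedAddCommGroup E] [NormedSpace ℝ E] [FiniteDimensional ℝ E]

lemma key_zero {𝒰 : Ultrafilter E} (h : (𝒰 : Filter E) ≤ 𝓝 0) (a b : An E) (hb : gφ 𝒰 b ≠ 0)
    (hp : ∀ f : An E, gφ 𝒰 f = 0 → ∀ᶠ z in 𝓝 (0 : E), f.1 z = 0)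
    (hyp : ∀ v, Tangent 𝒰 v → gφ 𝒰 b * gD 𝒰 v a = gφ 𝒰 a * gD 𝒰 v b) :
    ∃ c : ℝ, ∀ᶠ z in (𝒰 : Filter E), a.1 z = c * b.1 z := by
  have hT : ∀ w : E, Tangent 𝒰 (fun _ => w) := by
    intro w
    refine ⟨analyticAt_const, fun f hf => ?_⟩
    have h1 := gΦ_congr h (fun _ => w) f 0 (hp f hf)
    have := congrArg TrivSqZeroExt.snd h1
    simpa using this
  have ha' : AnalyticAt ℝ a.1 0 := a.2
  have hb' : AnalyticAt ℝ b.1 0 := b.2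
  let β := finBasis ℝ E
  have h2 : ∀ i, ∀ᶠ z in 𝓝 (0 : E), b.1 z * fderiv ℝ a.1 z (β i) - a.1 z * fderiv ℝ b.1 z (β i) = 0 := by
    intro i
    have han : AnalyticAt ℝ (fun z => b.1 z * fderiv ℝ a.1 z (β i) - a.1 z * fderiv ℝ b.1 z (β i)) 0 :=
      (hb'.mul (analyticAt_clm_apply ha'.fderiv analyticAt_const)).sub
        (ha'.mul (analyticAt_clm_apply hb'.fderiv analyticAt_const))
    refine hp ⟨_, han⟩ ?_
    have h3 := hyp _ (hT (β i))
    rw [gφ_zero]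
    have h4 := Filter.Germ.coe_eq.1 h3
    filter_upwards [h4] with z hz
    exact sub_eq_zero.2 hz
  have h3 : ∀ᶠ z in 𝓝 (0 : E), b.1 z • fderiv ℝ a.1 z - a.1 z • fderiv ℝ b.1 z = 0 := by
    filter_upwards [Filter.eventually_all.2 h2] with z hz
    refine ContinuousLinearMap.coe_injective (β.ext fun i => ?_)
    simpa using hz i
  obtain ⟨r, hr, hball⟩ := Metric.eventually_nhds_iff_ball.1
    (h3.and (ha'.eventually_analyticAt.and hb'.eventually_analyticAt))
  have hb0 : ∀ᶠ z in (𝒰 : Filter E), b.1 z ≠ 0 := by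
    rw [Ultrafilter.eventually_not]
    exact fun hh => hb (gφ_zero.2 hh)
  obtain ⟨y, hy0, hyr⟩ := (hb0.and (h (Metric.ball_mem_nhds 0 hr))).exists
  have hbc : ContinuousAt b.1 y := (hball y hyr).2.2.continuousAt
  obtain ⟨s, hs, hsb⟩ := Metric.eventually_nhds_iff_ball.1
    ((hbc.eventually (isOpen_ne.mem_nhds hy0)).and (Metric.isOpen_ball.mem_nhds hyr))
  obtain ⟨c, hc⟩ := Metric.isOpen_ball.exists_is_const_of_fderiv_eq_zero (𝕜 := ℝ) (s := ball y s)
    (f := fun z => a.1 z * (b.1 z)⁻¹) (convex_ball y s).isPreconnected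
    (fun z hz => (((hball z (hsb z hz).2).2.1.differentiableAt).mul
      ((hball z (hsb z hz).2).2.2.differentiableAt.inv (hsb z hz).1)).differentiableWithinAt)
    (fun z hz => by
      obtain ⟨hz0, hzr⟩ := hsb z hz
      obtain ⟨e1, e2, e3⟩ := hball z hzr
      have d2 := e2.differentiableAt.hasFDerivAt
      have d3 := (hasDerivAt_inv hz0).comp_hasFDerivAt z e3.differentiableAt.hasFDerivAt
      refine (d2.mul d3).fderiv.trans ?_
      refine ContinuousLinearMap.ext fun w => ?_
      have e4 := congrArg (fun L : E →L[ℝ] ℝ => L w) e1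
      simp at e4 ⊢
      field_simp
      linarith)
  refine ⟨c, h ?_⟩
  have hid := AnalyticOnNhd.eqOn_of_preconnected_of_eventuallyEq (𝕜 := ℝ) (f := a.1) (g := fun z => c * b.1 z) (U := ball 0 r)
    (z₀ := y) (fun z hz => (hball z hz).2.1) (fun z hz => analyticAt_const.mul (hball z hz).2.2)
    (convex_ball 0 r).isPreconnected hyr (by
      filter_upwards [Metric.ball_mem_nhds y hs] with z hz
      have := hc z hz
      rw [← this]
      have hz0 : b.1 z ≠ 0 := (hsb z hz).1
      field_simp)
  filter_upwards [Metric.ball_mem_nhds 0 hr] with z hz using hid hz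

lemma exists_dir {g : An E} (hg : ¬ ∀ᶠ z in 𝓝 (0 : E), g.1 z = 0) : ∃ e : E,
    ¬ ∀ᶠ t in 𝓝 (0 : ℝ), g.1 (t • e) = 0 := by
  have hg' : AnalyticAt ℝ g.1 0 := g.2
  obtain ⟨r, hr, hball⟩ := Metric.eventually_nhds_iff_ball.1 hg'.eventually_analyticAt
  have : ∃ y ∈ ball (0 : E) r, g.1 y ≠ 0 := by
    by_contra! hcon
    exact hg (Metric.eventually_nhds_iff_ball.2 ⟨r, hr, hcon⟩)
  obtain ⟨y, hy, hy0⟩ := this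
  refine ⟨y, fun hcon => hy0 ?_⟩
  have hmaps : ∀ t ∈ Icc (0 : ℝ) 1, t • y ∈ ball (0 : E) r := by
    intro t ht
    rw [mem_ball_zero_iff] at hy ⊢
    rw [norm_smul, Real.norm_of_nonneg ht.1]
    exact lt_of_le_of_lt (mul_le_of_le_one_left (norm_nonneg _) ht.2) hy
  have hid := AnalyticOnNhd.eqOn_of_preconnected_of_eventuallyEq (𝕜 := ℝ) (f := fun t : ℝ => g.1 (t • y))
    (g := fun _ => 0) (U := Icc 0 1) (z₀ := 0)
    (fun t ht => AnalyticAt.fun_comp (hball _ (hmaps t ht)) (analyticAt_id.smul analyticAt_const))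
    (fun t ht => analyticAt_const) isPreconnected_Icc (by simp) hcon
  simpa using hid (x := 1) (by simp)
end

end part_f

section part_g
open Module
section
open Polynomial
variable {E E' : Type*} [NormedAddCommGroup E] [NormedSpace ℝ E]
  [NormedAddCommGroup E'] [NormedSpace ℝ E']

def pb (π : E →L[ℝ] E') : An E' →+* An E where
  toFun f := ⟨fun z => f.1 (π z), by
    have h : AnalyticAt ℝ f.1 0 := f.2
    exact AnalyticAt.fun_comp (by simpa using h) (π.analyticAt 0)⟩
  map_one' := rfl
  map_zero' := rfl
  map_add' _ _ := rfl
  map_mul' _ _ := rfl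

def clmAn (τ : E →L[ℝ] ℝ) : An E := ⟨fun z => τ z, τ.analyticAt 0⟩

def evAt (z : E) : An E →+* ℝ := (Pi.evalRingHom (fun _ : E => ℝ) z).comp (An E).subtype

lemma evAt_apply (z : E) (f : An E) : evAt z f = f.1 z := rfl

lemma evAt_hat (π : E →L[ℝ] E') (τ : E →L[ℝ] ℝ) (z : E) (P : (An E')[X]) :
    (eval₂ (pb π) (clmAn τ) P).1 z = eval₂ (evAt (π z)) (τ z) P := by
  rw [← evAt_apply, hom_eval₂]
  rfl

def mkPoly {A : Type*} [CommRing A] {d : ℕ} (r : Fin d → A) : A[X] := ∑ i, C (r i) * X ^ (i : ℕ)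

lemma stepA [FiniteDimensional ℝ E] (ι : E' →L[ℝ] E) (e : E) (π : E →L[ℝ] E') (τ : E →L[ℝ] ℝ)
    (hz : ∀ z, z = ι (π z) + τ z • e) (hπe : π e = 0) (hτe : τ e = 1)
    {𝒰 : Ultrafilter E} (h : (𝒰 : Filter E) ≤ 𝓝 0) (g : An E) (hg0 : gφ 𝒰 g = 0)
    (hg : ¬ ∀ᶠ t in 𝓝 (0 : ℝ), g.1 (t • e) = 0) :
    ∃ W : (An E')[X], W.Monic ∧ gφ 𝒰 (eval₂ (pb π) (clmAn τ) W) = 0 ∧ ∀ f : An E, ∃ (q : An E) (P : (An E')[X]),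
      ∀ᶠ z in 𝓝 (0 : E), f.1 z = (q * eval₂ (pb π) (clmAn τ) W + eval₂ (pb π) (clmAn τ) P : An E).1 z := by
  have hhat : ∀ {d : ℕ} (r : Fin d → E' → ℝ) (hr : ∀ i, AnalyticAt ℝ (r i) 0) (z : E),
      (eval₂ (pb π) (clmAn τ) (mkPoly (fun i => (⟨r i, hr i⟩ : An E')))).1 z =
        ∑ i, r i (π z) * τ z ^ (i : ℕ) := by
    intro d r hr z
    rw [evAt_hat, mkPoly, eval₂_finsetSum]
    refine Finset.sum_congr rfl fun i _ => ?_
    simp [evAt_apply]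
  obtain ⟨d, hd⟩ := weierstrass_div' ι e g.2 hg π τ hz
  obtain ⟨q0, hq0, r0, hr0, h0⟩ := hd (fun z => τ z ^ d) ((τ.analyticAt 0).pow d)
  let W : (An E')[X] := X ^ d - mkPoly (fun i => (⟨r0 i, hr0 i⟩ : An E'))
  have hWm : W.Monic := by
    refine monic_X_pow_sub ?_
    have := degree_sum_fin_lt (fun i : Fin d => (⟨r0 i, hr0 i⟩ : An E'))
    exact this
  have hW : ∀ z, (eval₂ (pb π) (clmAn τ) W).1 z = τ z ^ d - ∑ i, r0 i (π z) * τ z ^ (i : ℕ) := by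
    intro z
    rw [← hhat r0 hr0, evAt_hat, evAt_hat, eval₂_sub, eval₂_X_pow]
  refine ⟨W, hWm, ?_, ?_⟩
  · rw [gφ_zero]
    filter_upwards [h h0, gφ_zero.1 hg0] with z hz1 hz2
    rw [hW, hz1, hz2]; ring
  · have hWne : ¬ ∀ᶠ t in 𝓝 (0 : ℝ), (eval₂ (pb π) (clmAn τ) W).1 (t • e) = 0 := by
      intro hcon
      have h3 : ∀ t : ℝ, (eval₂ (pb π) (clmAn τ) W).1 (t • e) = (W.map (evAt 0)).eval t := by
        intro t
        rw [evAt_hat, eval_map, map_smul, map_smul, hπe, hτe]; simp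
      simp only [h3] at hcon
      have h4 : W.map (evAt (0 : E')) ≠ 0 := (hWm.map _).ne_zero
      have h5 : {t | (W.map (evAt (0 : E'))).eval t = 0}.Finite := by
        refine (W.map (evAt (0 : E'))).roots.toFinset.finite_toSet.subset fun t ht => ?_
        simpa [h4] using ht
      exact (infinite_of_mem_nhds (0 : ℝ) hcon) h5
    obtain ⟨d', hd'⟩ := weierstrass_div' ι e (eval₂ (pb π) (clmAn τ) W).2 hWne π τ hz
    intro f
    obtain ⟨q, hq, r, hr, h5⟩ := hd' f.1 f.2
    refine ⟨⟨q, hq⟩, mkPoly (fun i => (⟨r i, hr i⟩ : An E')), ?_⟩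
    filter_upwards [h5] with z hz
    rw [hz, ← hhat r hr]; rfl
end

end part_g

section part_h
open Module
section
open Polynomial
variable {E E' : Type*} [NormedAddCommGroup E] [NormedSpace ℝ E]
  [NormedAddCommGroup E'] [NormedSpace ℝ E']

def φ2 (𝒰 : Ultrafilter E) (π : E →L[ℝ] E') : An E' →+* GK 𝒰 := (gφ 𝒰).comp (pb π)

def kSub (𝒰 : Ultrafilter E) (π : E →L[ℝ] E') : Subfield (GK 𝒰) := Subfield.closure (range (φ2 𝒰 π))

def ψ2 (𝒰 : Ultrafilter E) (π : E →L[ℝ] E') : An E' →+* kSub 𝒰 π :=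
  (φ2 𝒰 π).codRestrict (kSub 𝒰 π) (fun x => Subfield.subset_closure ⟨x, rfl⟩)

lemma ψ2_coe (𝒰 : Ultrafilter E) (π : E →L[ℝ] E') : (algebraMap (kSub 𝒰 π) (GK 𝒰)).comp (ψ2 𝒰 π) = φ2 𝒰 π := rfl

lemma ψ2_zero (𝒰 : Ultrafilter E) (π : E →L[ℝ] E') (a : An E') : ψ2 𝒰 π a = 0 ↔ φ2 𝒰 π a = 0 := by
  rw [← ψ2_coe]; simp

lemma ψ2_quot (𝒰 : Ultrafilter E) (π : E →L[ℝ] E') (x : kSub 𝒰 π) :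
    ∃ a b, ψ2 𝒰 π b ≠ 0 ∧ x = ψ2 𝒰 π a / ψ2 𝒰 π b := by
  obtain ⟨x, hx⟩ := x
  obtain ⟨y, hy, z, hz, rfl⟩ := Subfield.mem_closure_iff.1 hx
  have hcl : ∀ y ∈ Subring.closure (range (φ2 𝒰 π)), ∃ a, φ2 𝒰 π a = y := by
    intro y hy
    have : Subring.closure (range (φ2 𝒰 π)) ≤ (φ2 𝒰 π).range := by
      rw [Subring.closure_le]; rintro _ ⟨a, rfl⟩; exact ⟨a, rfl⟩
    exact this hy
  obtain ⟨a, rfl⟩ := hcl y hy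
  obtain ⟨b, rfl⟩ := hcl z hz
  by_cases hb : φ2 𝒰 π b = 0
  · refine ⟨0, 1, by simp, ?_⟩
    ext; simp [hb]
  · exact ⟨a, b, fun hh => hb ((ψ2_zero _ _ _).1 hh), rfl⟩

lemma φ2_zero {𝒰 : Ultrafilter E} {π : E →L[ℝ] E'} {a : An E'} : gφ (𝒰.map π) a = 0 ↔ φ2 𝒰 π a = 0 := by
  rw [gφ_zero, φ2, RingHom.comp_apply, gφ_zero]
  rfl

def dv (v : E' → E') (hv : AnalyticAt ℝ v 0) (f : An E') : An E' :=
  ⟨fun x => fderiv ℝ f.1 x (v x), by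
    have h : AnalyticAt ℝ f.1 0 := f.2
    exact analyticAt_clm_apply h.fderiv hv⟩

lemma map_le {𝒰 : Ultrafilter E} (h : (𝒰 : Filter E) ≤ 𝓝 0) (π : E →L[ℝ] E') :
    ((𝒰.map π : Ultrafilter E') : Filter E') ≤ 𝓝 0 := by
  have : Filter.Tendsto π (𝓝 0) (𝓝 0) := by simpa using π.continuous.tendsto 0
  exact this.mono_left h

def D2 {𝒰 : Ultrafilter E} (h : (𝒰 : Filter E) ≤ 𝓝 0) (π : E →L[ℝ] E')
    (v : E' → E') (hv : AnalyticAt ℝ v 0) : An E' →+ GK 𝒰 :=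
  AddMonoidHom.mk' (fun f => φ2 𝒰 π (dv v hv f)) (by
    intro f g
    rw [← map_add, ← sub_eq_zero, ← map_sub, ← φ2_zero, map_sub, sub_eq_zero, gφ_eq]
    filter_upwards [map_le h π (An_diff f), map_le h π (An_diff g)] with z hf hg
    exact congrArg (fun L : E' →L[ℝ] ℝ => L (v z)) (fderiv_add hf hg))

lemma stepV (ι : E' →L[ℝ] E) (e : E) (π : E →L[ℝ] E') (τ : E →L[ℝ] ℝ)
    (hπι : ∀ x, π (ι x) = x) (hτι : ∀ x, τ (ι x) = 0) (hπe : π e = 0) (hτe : τ e = 1)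
    {𝒰 : Ultrafilter E} (h : (𝒰 : Filter E) ≤ 𝓝 0)
    (W : (An E')[X]) (hWm : W.Monic) (hW0 : gφ 𝒰 (eval₂ (pb π) (clmAn τ) W) = 0)
    (hdiv : ∀ f : An E, ∃ (q : An E) (P : (An E')[X]),
      ∀ᶠ z in 𝓝 (0 : E), f.1 z = (q * eval₂ (pb π) (clmAn τ) W + eval₂ (pb π) (clmAn τ) P : An E).1 z)
    (v' : E' → E') (hv : AnalyticAt ℝ v' 0) (hT : Tangent (𝒰.map π) v') :
    ∃ (v : E → E) (δ : An E), Tangent 𝒰 v ∧ gφ 𝒰 δ ≠ 0 ∧ ∀ f : An E', gD 𝒰 v (pb π f) = gφ 𝒰 δ * φ2 𝒰 π (dv v' hv f) := by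
  have hφ : ∀ P : (An E')[X], gφ 𝒰 (eval₂ (pb π) (clmAn τ) P) = eval₂ (φ2 𝒰 π) (gφ 𝒰 (clmAn τ)) P := by
    intro P; rw [hom_eval₂]; rfl
  have hIntg : IsIntegral (kSub 𝒰 π) (gφ 𝒰 (clmAn τ)) := by
    refine ⟨W.map (ψ2 𝒰 π), hWm.map _, ?_⟩
    rw [eval₂_map, ψ2_coe, ← hφ, hW0]
  obtain ⟨Q, hQ0, hQ1, hQ2⟩ := algL1 (ψ2 𝒰 π) (ψ2_quot 𝒰 π) hIntg
  rw [ψ2_coe] at hQ0 hQ1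
  let δ : An E := eval₂ (pb π) (clmAn τ) (derivative Q)
  let n : An E := -(Q.sum fun i a => pb π (dv v' hv a) * (clmAn τ) ^ i)
  let v : E → E := fun z => δ.1 z • ι (v' (π z)) + n.1 z • e
  have hvan : AnalyticAt ℝ v 0 := by
    have h1 : AnalyticAt ℝ δ.1 0 := δ.2
    have h2 : AnalyticAt ℝ n.1 0 := n.2
    have h3 : AnalyticAt ℝ (fun z => v' (π z)) 0 := AnalyticAt.fun_comp (by simpa using hv) (π.analyticAt 0)
    have h4 : AnalyticAt ℝ (fun z => ι (v' (π z))) 0 := AnalyticAt.fun_comp (ι.analyticAt _) h3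
    exact (h1.smul h4).add (h2.smul analyticAt_const)
  have hδ : gφ 𝒰 δ = eval₂ (φ2 𝒰 π) (gφ 𝒰 (clmAn τ)) (derivative Q) := hφ _
  have hn : gφ 𝒰 n = -(Q.sum fun i a => D2 h π v' hv a * (gφ 𝒰 (clmAn τ)) ^ i) := by
    simp only [n, Polynomial.sum, map_neg, map_sum, map_mul, map_pow]
    rfl
  have hDf : ∀ f : An E', gD 𝒰 v (pb π f) = gφ 𝒰 δ * φ2 𝒰 π (dv v' hv f) := by
    intro f
    refine Filter.Germ.coe_eq.2 ?_
    filter_upwards [map_le h π (An_diff f)] with z hz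
    have h1 : HasFDerivAt (fun z => f.1 (π z)) ((fderiv ℝ f.1 (π z)).comp π) z :=
      HasFDerivAt.comp z (DifferentiableAt.hasFDerivAt hz) π.hasFDerivAt
    have h2 : fderiv ℝ ((pb π f : An E) : E → ℝ) z = (fderiv ℝ f.1 (π z)).comp π := h1.fderiv
    rw [h2]
    simp only [ContinuousLinearMap.comp_apply, v, map_add, map_smul, hπι, hπe, map_zero, mul_zero, add_zero, smul_eq_mul]
    rfl
  have hDt : gD 𝒰 v (clmAn τ) = gφ 𝒰 n := by
    refine Filter.Germ.coe_eq.2 (Filter.Eventually.of_forall fun z => ?_)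
    have h2 : fderiv ℝ ((clmAn τ : An E) : E → ℝ) z = τ := τ.fderiv
    beta_reduce
    rw [h2]
    simp [v, hτι, hτe]
  let Φ : An E' →+* DualNumber (GK 𝒰) := (gΦ 𝒰 h v).comp (pb π)
  have hΦ0 : ∀ a, ψ2 𝒰 π a = 0 → Φ a = 0 := by
    intro a ha
    rw [ψ2_zero] at ha
    ext
    · exact (gΦ_fst h v _).trans ha
    · refine (gΦ_snd h v _).trans ?_
      rw [hDf, φ2_zero.1 (hT.2 a (φ2_zero.2 ha)), mul_zero, TrivSqZeroExt.snd_zero]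
  have hy : gΦ 𝒰 h v (clmAn τ) = TrivSqZeroExt.inl (gφ 𝒰 (clmAn τ)) + TrivSqZeroExt.inr (gφ 𝒰 n) := by
    rw [← hDt]; rfl
  have hΦP : ∀ P : (An E')[X], gΦ 𝒰 h v (eval₂ (pb π) (clmAn τ) P) = eval₂ Φ (gΦ 𝒰 h v (clmAn τ)) P := by
    intro P; rw [hom_eval₂]
  have hQΦ : eval₂ Φ (gΦ 𝒰 h v (clmAn τ)) Q = 0 := by
    obtain ⟨e1, e2⟩ := dual_eval (Φ := Φ) (gφ 𝒰 (clmAn τ)) (gφ 𝒰 n) (gφ 𝒰 δ) Q (D2 h π v' hv) (φ2 𝒰 π)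
      (fun a => gΦ_fst h v _) (fun a => (gΦ_snd h v _).trans (hDf a))
    rw [hy]
    ext
    · rw [e1, hQ0]; rfl
    · rw [e2, hn, hδ, TrivSqZeroExt.snd_zero]; ring
  have hkill : ∀ P : (An E')[X], gφ 𝒰 (eval₂ (pb π) (clmAn τ) P) = 0 → gΦ 𝒰 h v (eval₂ (pb π) (clmAn τ) P) = 0 := by
    intro P hP
    rw [hΦP]
    refine algL2 (ψ2 𝒰 π) (fun a => gΦ_fst h v _) hΦ0 hQΦ hQ2 P ?_
    rw [ψ2_coe, ← hφ, hP]
  refine ⟨v, δ, ⟨hvan, fun f hf => ?_⟩, by rw [hδ]; exact hQ1, hDf⟩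
  obtain ⟨q, P, hqP⟩ := hdiv f
  have h1 := gΦ_congr h v f _ hqP
  have h2 : gφ 𝒰 (eval₂ (pb π) (clmAn τ) P) = 0 := by
    have := gφ_eq.2 (h hqP)
    rw [hf, map_add, map_mul, hW0, mul_zero, zero_add] at this
    exact this.symm
  rw [map_add, map_mul, hkill W hW0, hkill P h2, mul_zero, add_zero] at h1
  rw [← gΦ_snd h v f, h1]; rfl
end

end part_h

section part_i
open Module
section
open Polynomial

lemma homog_sum {R : Type*} [CommRing R] (N : ℕ) (c : ℕ → R) (x A B : R) (hA : A = x * B) :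
    ∑ i ∈ Finset.range (N + 1), c i * A ^ i * B ^ (N - i) = B ^ N * ∑ i ∈ Finset.range (N + 1), c i * x ^ i := by
  rw [Finset.mul_sum]
  refine Finset.sum_congr rfl fun i hi => ?_
  have h1 : N = i + (N - i) := by have := Finset.mem_range.1 hi; omega
  have h2 : B ^ N = B ^ i * B ^ (N - i) := by rw [← pow_add, ← h1]
  rw [h2, hA, mul_pow]; ring

variable {E E' : Type*} [NormedAddCommGroup E] [NormedSpace ℝ E]
  [NormedAddCommGroup E'] [NormedSpace ℝ E']

lemma stepB [FiniteDimensional ℝ E] (IH : KeyProp E') (ι : E' →L[ℝ] E) (e : E) (π : E →L[ℝ] E') (τ : E →L[ℝ] ℝ)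
    (hz : ∀ z, z = ι (π z) + τ z • e)
    (hπι : ∀ x, π (ι x) = x) (hτι : ∀ x, τ (ι x) = 0) (hπe : π e = 0) (hτe : τ e = 1)
    {𝒰 : Ultrafilter E} (h : (𝒰 : Filter E) ≤ 𝓝 0) (g : An E) (hg0 : gφ 𝒰 g = 0)
    (hg : ¬ ∀ᶠ t in 𝓝 (0 : ℝ), g.1 (t • e) = 0)
    (a b : An E) (hb : gφ 𝒰 b ≠ 0)
    (hyp : ∀ v, Tangent 𝒰 v → gφ 𝒰 b * gD 𝒰 v a = gφ 𝒰 a * gD 𝒰 v b) :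
    ∃ c : ℝ, ∀ᶠ z in (𝒰 : Filter E), a.1 z = c * b.1 z := by
  obtain ⟨W, hWm, hW0, hdiv⟩ := stepA ι e π τ hz hπe hτe h g hg0 hg
  have hφ : ∀ P : (An E')[X], gφ 𝒰 (eval₂ (pb π) (clmAn τ) P) = eval₂ (φ2 𝒰 π) (gφ 𝒰 (clmAn τ)) P := by
    intro P; rw [hom_eval₂]; rfl
  have hIntg : IsIntegral (kSub 𝒰 π) (gφ 𝒰 (clmAn τ)) := by
    refine ⟨W.map (ψ2 𝒰 π), hWm.map _, ?_⟩
    rw [eval₂_map, ψ2_coe, ← hφ, hW0]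
  have hIntgf : ∀ f : An E, IsIntegral (kSub 𝒰 π) (gφ 𝒰 f) := by
    intro f
    obtain ⟨q, P, hqP⟩ := hdiv f
    have := gφ_eq.2 (h hqP)
    rw [map_add, map_mul, hW0, mul_zero, zero_add, hφ, ← ψ2_coe, ← eval₂_map, ← aeval_def, aeval_eq_sum_range] at this
    rw [this]
    exact IsIntegral.sum _ fun i _ => (hIntg.pow i).smul _
  have hξ : IsIntegral (kSub 𝒰 π) (gφ 𝒰 a / gφ 𝒰 b) := by
    rw [div_eq_mul_inv]; exact (hIntgf a).mul (hIntgf b).inv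
  set ξ := gφ 𝒰 a / gφ 𝒰 b with hξdef
  have haξ : gφ 𝒰 a = ξ * gφ 𝒰 b := by rw [hξdef]; field_simp
  obtain ⟨N, m, hmN, hmN0, hm0, hmin⟩ := algL3 (ψ2 𝒰 π) (ψ2_quot 𝒰 π) hξ
  rw [ψ2_coe] at hm0
  rw [eval₂_eq_sum_range' _ (Nat.lt_succ_of_le hmN)] at hm0
  let H : An E := ∑ i ∈ Finset.range (N + 1), pb π (m.coeff i) * a ^ i * b ^ (N - i)
  have hH0 : gφ 𝒰 H = 0 := by
    simp only [H, map_sum, map_mul, map_pow]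
    rw [homog_sum N (fun i => gφ 𝒰 (pb π (m.coeff i))) ξ _ _ haξ]
    have : ∑ i ∈ Finset.range (N + 1), gφ 𝒰 (pb π (m.coeff i)) * ξ ^ i = 0 := hm0
    rw [this, mul_zero]
  have key : ∀ v', Tangent (𝒰.map π) v' → ∀ i,
      gφ (𝒰.map π) (m.coeff N) * gD (𝒰.map π) v' (m.coeff i) = gφ (𝒰.map π) (m.coeff i) * gD (𝒰.map π) v' (m.coeff N) := by
    intro v' hT' i
    obtain ⟨v, δ, hT, hδ, hD⟩ := stepV ι e π τ hπι hτι hπe hτe h W hWm hW0 hdiv v' hT'.1 hT'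
    have hΦH : gΦ 𝒰 h v H = 0 := by
      ext
      · simpa using hH0
      · simpa using hT.2 H hH0
    have hΦa : gΦ 𝒰 h v a = TrivSqZeroExt.inl ξ * gΦ 𝒰 h v b := by
      ext
      · simpa using haξ
      · have := hyp v hT
        simp [hξdef]
        field_simp
        rw [← this, mul_comm]
    simp only [H, map_sum, map_mul, map_pow] at hΦH
    rw [homog_sum N (fun i => gΦ 𝒰 h v (pb π (m.coeff i))) _ _ _ hΦa] at hΦH
    have hu : IsUnit (gΦ 𝒰 h v b ^ N) := by
      refine IsUnit.pow N ?_
      rw [TrivSqZeroExt.isUnit_iff_isUnit_fst, gΦ_fst]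
      exact hb.isUnit
    have h3 := (hu.mul_right_eq_zero).1 hΦH
    have h4 := congrArg TrivSqZeroExt.snd h3
    rw [TrivSqZeroExt.snd_sum] at h4
    simp only [TrivSqZeroExt.inl_pow, TrivSqZeroExt.snd_mul, TrivSqZeroExt.snd_inl, TrivSqZeroExt.fst_inl, gΦ_snd, hD,
      smul_zero, zero_add, MulOpposite.smul_eq_mul_unop, MulOpposite.unop_op, TrivSqZeroExt.snd_zero, mul_assoc] at h4
    rw [← Finset.mul_sum] at h4
    have h5 := (mul_eq_zero.1 h4).resolve_left hδ
    let P : (An E')[X] := ∑ i ∈ Finset.range (N + 1), monomial i (dv v' hT'.1 (m.coeff i))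
    have hPc : ∀ i ≤ N, P.coeff i = dv v' hT'.1 (m.coeff i) := by
      intro i hi
      simp only [P, finsetSum_coeff, coeff_monomial]
      rw [Finset.sum_ite_eq' , if_pos (Finset.mem_range.2 (by omega))]
    have hPN : P.natDegree ≤ N := by
      refine natDegree_sum_le_of_forall_le _ _ fun i hi => (natDegree_monomial_le _).trans ?_
      have := Finset.mem_range.1 hi; omega
    have hP0 : eval₂ (φ2 𝒰 π) ξ P = 0 := by
      rw [← h5]
      simp only [P, eval₂_finsetSum, eval₂_monomial]
    by_cases hi : i ≤ N
    · have h6 := hmin P hPN (by rw [ψ2_coe]; exact hP0) i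
      rw [hPc i hi, hPc N le_rfl, ← map_mul, ← map_mul, ← sub_eq_zero, ← map_sub, ψ2_zero, ← φ2_zero, map_sub, sub_eq_zero,
        map_mul, map_mul] at h6
      exact h6.trans (mul_comm _ _)
    · have h7 : m.coeff i = 0 := coeff_eq_zero_of_natDegree_lt (by omega)
      have h8 := hT'.2 0 (map_zero _)
      rw [h7, h8, map_zero, mul_zero, zero_mul]
  have hmN1 : gφ (𝒰.map π) (m.coeff N) ≠ 0 := by
    intro hh; exact hmN0 ((ψ2_zero _ _ _).2 (φ2_zero.1 hh))
  choose c hc using fun i => IH (𝒰.map π) (map_le h π) (m.coeff i) (m.coeff N) hmN1 (fun v' hv' => key v' hv' i)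
  let p : ℝ[X] := ∑ i ∈ Finset.range (N + 1), monomial i (c i)
  have hN0' : ∀ᶠ z in (𝒰 : Filter E), (m.coeff N).1 (π z) ≠ 0 := by
    rw [Ultrafilter.eventually_not]
    exact fun hh => hmN1 (gφ_zero.2 hh)
  have hb0 : ∀ᶠ z in (𝒰 : Filter E), b.1 z ≠ 0 := by
    rw [Ultrafilter.eventually_not]
    exact fun hh => hb (gφ_zero.2 hh)
  have hp : p ≠ 0 := by
    intro hp0
    have h1 : p.coeff N = c N := by
      simp only [p, finsetSum_coeff, coeff_monomial]
      rw [Finset.sum_ite_eq' , if_pos (Finset.mem_range.2 (by omega))]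
    rw [hp0, coeff_zero] at h1
    obtain ⟨z, hz1, hz2⟩ := (hN0'.and (hc N)).exists
    have hz3 : (m.coeff N).1 (π z) = c N * (m.coeff N).1 (π z) := hz2
    rw [← h1, zero_mul] at hz3
    exact hz1 hz3
  have hall : ∀ᶠ z in (𝒰 : Filter E), ∀ i ∈ Finset.range (N + 1), (m.coeff i).1 (π z) = c i * (m.coeff N).1 (π z) :=
    (Finset.eventually_all _).2 fun i _ => hc i
  have hroot : ∀ᶠ z in (𝒰 : Filter E), p.eval (a.1 z / b.1 z) = 0 := by
    filter_upwards [hall, hN0', hb0, gφ_zero.1 hH0] with z h1 h2 h3 h4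
    have h5 : ∑ i ∈ Finset.range (N + 1), (m.coeff i).1 (π z) * (a.1 z) ^ i * (b.1 z) ^ (N - i) = 0 := by
      have h8 : evAt z H = 0 := h4
      rw [← h8]
      simp only [H, map_sum, map_mul, map_pow]
      rfl
    rw [homog_sum N (fun i => (m.coeff i).1 (π z)) (a.1 z / b.1 z) _ _ (by field_simp)] at h5
    have h6 := (mul_eq_zero.1 h5).resolve_left (pow_ne_zero _ h3)
    rw [Finset.sum_congr rfl (g := fun i => (m.coeff N).1 (π z) * (c i * (a.1 z / b.1 z) ^ i))
      (fun i hi => by rw [h1 i hi]; ring), ← Finset.mul_sum] at h6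
    have h7 := (mul_eq_zero.1 h6).resolve_left h2
    simpa [p, eval_finsetSum] using h7
  have hfin : ∀ᶠ z in (𝒰 : Filter E), ∃ x ∈ p.roots.toFinset, a.1 z / b.1 z = x := by
    filter_upwards [hroot] with z hz
    exact ⟨_, by simp [hp, hz], rfl⟩
  obtain ⟨x, hx, hx2⟩ := (Ultrafilter.eventually_exists_mem_iff p.roots.toFinset.finite_toSet).1 hfin
  refine ⟨x, ?_⟩
  filter_upwards [hx2, hb0] with z h1 h2
  rw [← h1]; field_simp
end

end part_i

section part_j
open Module
section
universe u

theorem keyProp_aux (n : ℕ) : ∀ (E : Type u) [NormedAddCommGroup E] [NormedSpace ℝ E] [FiniteDimensional ℝ E],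
    finrank ℝ E = n → KeyProp E := by
  induction n using Nat.strong_induction_on with
  | _ n ih =>
  intro E _ _ _ hn 𝒰 h a b hb hyp
  by_cases hp : ∀ f : An E, gφ 𝒰 f = 0 → ∀ᶠ z in 𝓝 (0 : E), f.1 z = 0
  · exact key_zero h a b hb hp hyp
  push Not at hp
  obtain ⟨g, hg0, hg⟩ := hp
  obtain ⟨e, he⟩ := exists_dir (g := g) (by simpa using hg)
  have hg00 : g.1 0 = 0 := by
    have hga : AnalyticAt ℝ g.1 0 := g.2
    have h1 : Filter.Tendsto g.1 𝒰 (𝓝 (g.1 0)) := hga.continuousAt.tendsto.mono_left h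
    have h2 : Filter.Tendsto g.1 𝒰 (𝓝 0) :=
      tendsto_const_nhds.congr' ((gφ_zero.1 hg0).mono fun z hz => hz.symm)
    exact tendsto_nhds_unique h1 h2
  have he0 : e ≠ 0 := by
    rintro rfl
    exact he (by simp [hg00])
  obtain ⟨τ, hτ⟩ := SeparatingDual.exists_eq_one (R := ℝ) he0
  let E' : Submodule ℝ E := LinearMap.ker (τ : E →ₗ[ℝ] ℝ)
  have hlt : finrank ℝ E' < n := by
    rw [← hn]
    refine Submodule.finrank_lt (fun ht => ?_)
    have : e ∈ E' := ht ▸ Submodule.mem_top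
    have h3 : τ e = 0 := this
    rw [hτ] at h3; exact one_ne_zero h3
  have IH := ih _ hlt E' rfl
  let π : E →L[ℝ] E' := ((ContinuousLinearMap.id ℝ E) - τ.smulRight e).codRestrict E' (fun z => by
    change τ _ = 0
    simp [hτ])
  have hπ : ∀ z, ((π z : E') : E) = z - τ z • e := fun z => rfl
  refine stepB IH E'.subtypeL e π τ ?_ ?_ ?_ ?_ hτ h g hg0 he a b hb hyp
  · intro z; simp [hπ]
  · rintro ⟨x, hx⟩
    ext
    have hx' : τ x = 0 := hx
    simp [hπ, hx']
  · rintro ⟨x, hx⟩; exact hx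
  · ext; simp [hπ, hτ]

theorem theoremT {E : Type u} [NormedAddCommGroup E] [InnerProductSpace ℝ E] [FiniteDimensional ℝ E] {n : ℕ}
    {F : E → EuclideanSpace ℝ (Fin n)} (hF : AnalyticAt ℝ F 0) :
    ∀ᶠ z in 𝓝 (0 : E), F z = 0 → (∀ v, fderiv ℝ F z v = 0 → inner ℝ z v = 0) → z = 0 := by
  by_contra hcon
  rw [Filter.not_eventually] at hcon
  have hne : (𝓝 (0 : E) ⊓ Filter.principal {z | ¬ (F z = 0 → (∀ v, fderiv ℝ F z v = 0 → inner ℝ z v = 0) → z = 0)}).NeBot :=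
    Filter.frequently_mem_iff_neBot.1 hcon
  let 𝒰 := Ultrafilter.of (𝓝 (0 : E) ⊓ Filter.principal {z | ¬ (F z = 0 → (∀ v, fderiv ℝ F z v = 0 → inner ℝ z v = 0) → z = 0)})
  have h𝒰 := Ultrafilter.of_le (𝓝 (0 : E) ⊓ Filter.principal {z | ¬ (F z = 0 → (∀ v, fderiv ℝ F z v = 0 → inner ℝ z v = 0) → z = 0)})
  have h : (𝒰 : Filter E) ≤ 𝓝 0 := h𝒰.trans inf_le_left
  have hbad : ∀ᶠ z in (𝒰 : Filter E), F z = 0 ∧ (∀ v, fderiv ℝ F z v = 0 → inner ℝ z v = 0) ∧ z ≠ 0 := by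
    filter_upwards [(h𝒰.trans inf_le_right) (Filter.mem_principal_self _)] with z hz
    simpa using hz
  have han : AnalyticAt ℝ (fun z : E => ‖z‖ ^ 2) 0 := ((contDiff_norm_sq ℝ (n := ⊤)).contDiffAt).analyticAt
  obtain ⟨c, hc⟩ := keyProp_aux _ E rfl 𝒰 h ⟨_, han⟩ 1 (by simp) (by
    intro v hv
    have h1 : gD 𝒰 v ((1 : An E) : E → ℝ) = 0 := by
      have := congrArg TrivSqZeroExt.snd (map_one (gΦ 𝒰 h v))
      rw [gΦ_snd] at this; exact this
    rw [h1, map_one, one_mul, mul_zero]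
    have h2 : ∀ i, ∀ᶠ z in (𝒰 : Filter E), fderiv ℝ F z (v z) i = 0 := by
      intro i
      have hFi : AnalyticAt ℝ (fun z => F z i) 0 :=
        AnalyticAt.fun_comp ((EuclideanSpace.proj i : EuclideanSpace ℝ (Fin n) →L[ℝ] ℝ).analyticAt _) hF
      have h3 := hv.2 ⟨_, hFi⟩ (gφ_zero.2 (hbad.mono fun z hz => by simp [hz.1]))
      have h4 := Filter.Germ.coe_eq.1 h3
      filter_upwards [h4, h hF.eventually_analyticAt] with z h5 h6
      have h7 : HasFDerivAt (fun z => F z i) ((EuclideanSpace.proj i : EuclideanSpace ℝ (Fin n) →L[ℝ] ℝ).comp (fderiv ℝ F z)) z :=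
        HasFDerivAt.comp z (EuclideanSpace.proj i : EuclideanSpace ℝ (Fin n) →L[ℝ] ℝ).hasFDerivAt (AnalyticAt.differentiableAt h6).hasFDerivAt
      rw [h7.fderiv] at h5
      exact h5
    refine Filter.Germ.coe_eq.2 ?_
    filter_upwards [Filter.eventually_all.2 h2, hbad] with z h3 h4
    have h5 := h4.2.1 (v z) (by ext i; exact h3 i)
    have h6 := (hasStrictFDerivAt_norm_sq z).hasFDerivAt.fderiv
    beta_reduce
    rw [h6]; simp [h5])
  have hc' : ∀ᶠ z in (𝒰 : Filter E), ‖z‖ ^ 2 = c := hc.mono fun z hz => hz.trans (mul_one c)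
  have hc0 : c = 0 := by
    have h1 : Filter.Tendsto (fun z : E => ‖z‖ ^ 2) 𝒰 (𝓝 (‖(0 : E)‖ ^ 2)) := han.continuousAt.tendsto.mono_left h
    have h2 : Filter.Tendsto (fun z : E => ‖z‖ ^ 2) 𝒰 (𝓝 c) :=
      tendsto_const_nhds.congr' (hc'.mono fun z hz => hz.symm)
    have := tendsto_nhds_unique h1 h2
    simpa using this.symm
  obtain ⟨z, h1, h2⟩ := (hc'.and hbad).exists
  rw [hc0] at h1
  exact h2.2.2 (by simpa using h1)
end

end part_j

section final
open Module

lemma surj_nhds {X Y : Type*} [NormedAddCommGroup X] [NormedSpace ℝ X] [NormedAddCommGroup Y] [NormedSpace ℝ Y]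
    [FiniteDimensional ℝ Y] (L : X →L[ℝ] Y) (hL : Surjective L) : ∀ᶠ L' : X →L[ℝ] Y in 𝓝 L, Surjective L' := by
  have : CompleteSpace Y := FiniteDimensional.complete ℝ Y
  obtain ⟨R, hR⟩ := LinearMap.exists_rightInverse_of_surjective (L : X →ₗ[ℝ] Y) (LinearMap.range_eq_top.2 hL)
  let R' : Y →L[ℝ] X := LinearMap.toContinuousLinearMap R
  have hR1 : L.comp R' = 1 := ContinuousLinearMap.ext fun y => congrArg (fun A : Y →ₗ[ℝ] Y => A y) hR
  have hc : Continuous (fun L' : X →L[ℝ] Y => L'.comp R') := by fun_prop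
  have hu : ∀ᶠ L' in 𝓝 L, IsUnit (L'.comp R') := 
    hc.continuousAt.eventually (Units.isOpen.mem_nhds (by change IsUnit (L.comp R'); rw [hR1]; exact isUnit_one))
  filter_upwards [hu] with L' h y
  obtain ⟨u, hu⟩ := h
  refine ⟨R' ((↑u⁻¹ : Y →L[ℝ] Y) y), ?_⟩
  have h1 := congrArg (fun A : Y →L[ℝ] Y => A y) (u.mul_inv)
  rw [hu] at h1
  exact h1

variable {E Y : Type*} [NormedAddCommGroup E] [InnerProductSpace ℝ E] [NormedAddCommGroup Y] [NormedSpace ℝ Y]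

lemma fderiv_milnor {P : E → Y} {x : E} (hP : DifferentiableAt ℝ P x) :
    fderiv ℝ (fun y => (P y, ‖y‖ ^ 2)) x = (fderiv ℝ P x).prod (2 • innerSL ℝ x) :=
  (hP.hasFDerivAt.prodMk (hasStrictFDerivAt_norm_sq x).hasFDerivAt).fderiv

lemma ker_of_milnor {P : E → Y} {x : E} (hP : DifferentiableAt ℝ P x) (hx : x ∈ MilnorSet P) (hS : x ∉ Sing P) 
    (v : E) (hv : fderiv ℝ P x v = 0) : inner ℝ x v = 0 := by
  by_contra hne
  apply hx
  rw [fderiv_milnor hP]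
  have hS' : Surjective (fderiv ℝ P x) := by simpa [Sing] using hS
  rintro ⟨y, s⟩
  obtain ⟨u, rfl⟩ := hS' y
  refine ⟨u + ((s / 2 - inner ℝ x u) / inner ℝ x v) • v, ?_⟩
  ext
  · simp [hv]
  · simp [inner_add_right, inner_smul_right]
    field_simp
    ring

lemma milnor_of_ker {P : E → Y} {x : E} (hP : DifferentiableAt ℝ P x)
    (h : ∀ v, fderiv ℝ P x v = 0 → inner ℝ x v = 0) : x ∈ MilnorSet P := by
  intro hs
  rw [fderiv_milnor hP] at hs
  obtain ⟨v, hv⟩ := hs (0, 1)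
  have h1 : fderiv ℝ P x v = 0 := congrArg Prod.fst hv
  have h2 : (2 • innerSL ℝ x) v = 1 := congrArg Prod.snd hv
  simp [h v h1] at h2
end final

/-- Assume F is tame with Disc F ⊆ {0} and Sing G ⊆ {0} on V.
Then H = G ∘ F is tame. -/
theorem stmt_13 {M N K : ℕ} (hMN : M ≥ N) (hNK : N ≥ K) (hK2 : K ≥ 2)
    (U : Set (EuclideanSpace ℝ (Fin M))) (V : Set (EuclideanSpace ℝ (Fin N)))
    (hUopen : IsOpen U) (hU0 : (0 : EuclideanSpace ℝ (Fin M)) ∈ U)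
    (hVopen : IsOpen V) (hV0 : (0 : EuclideanSpace ℝ (Fin N)) ∈ V)
    (F : EuclideanSpace ℝ (Fin M) → EuclideanSpace ℝ (Fin N))
    (G : EuclideanSpace ℝ (Fin N) → EuclideanSpace ℝ (Fin K))
    (hF : AnalyticOnNhd ℝ F U) (hG : AnalyticOnNhd ℝ G V)
    (hF0 : F 0 = 0) (hG0 : G 0 = 0) (hFUV : F '' U ⊆ V)
    (hFtame : Tame F) (hDiscF : F '' (Sing F ∩ U) ⊆ {0})
    (hSingG : Sing G ∩ V ⊆ {0})
    (H : EuclideanSpace ℝ (Fin M) → EuclideanSpace ℝ (Fin K)) (hH : H = G ∘ F) :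
    Tame H := by
  obtain ⟨ε₁, hε₁, hF1⟩ := hFtame
  obtain ⟨ε₂, hε₂, hU2⟩ := Metric.isOpen_iff.1 hUopen 0 hU0
  obtain ⟨ε₃, hε₃, hT⟩ := Metric.eventually_nhds_iff_ball.1 (theoremT (hF 0 hU0))
  refine ⟨min ε₁ (min ε₂ ε₃), by positivity, ?_⟩
  set ε := min ε₁ (min ε₂ ε₃) with hε
  have b1 : ball (0 : EuclideanSpace ℝ (Fin M)) ε ⊆ ball 0 ε₁ := ball_subset_ball (min_le_left _ _)
  have b2 : ball (0 : EuclideanSpace ℝ (Fin M)) ε ⊆ U := 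
    (ball_subset_ball ((min_le_right _ _).trans (min_le_left _ _))).trans hU2
  have b3 : ball (0 : EuclideanSpace ℝ (Fin M)) ε ⊆ ball 0 ε₃ := 
    ball_subset_ball ((min_le_right _ _).trans (min_le_right _ _))
  have hdF : ∀ x ∈ U, DifferentiableAt ℝ F x := fun x hx => (hF x hx).differentiableAt
  have hdG : ∀ x ∈ U, DifferentiableAt ℝ G (F x) := fun x hx => (hG _ (hFUV ⟨x, hx, rfl⟩)).differentiableAt
  have hdH : ∀ x ∈ U, HasFDerivAt H ((fderiv ℝ G (F x)).comp (fderiv ℝ F x)) x := by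
    intro x hx
    rw [hH]
    exact (hdG x hx).hasFDerivAt.comp x (hdF x hx).hasFDerivAt
  rintro z ⟨⟨hzc, hzS⟩, hzb⟩
  by_contra hz0
  have hz0' : z ≠ 0 := hz0
  have hnotS : ∀ x ∈ U, F x ≠ 0 → x ∉ Sing F := fun x hx hFx hS => hFx (hDiscF ⟨x, ⟨hS, hx⟩, rfl⟩)
  have hzc' : z ∈ closure ((MilnorSet F \ Sing F) ∩ ball 0 ε₁) := by
    rw [mem_closure_iff_frequently] at hzc ⊢
    refine (hzc.and_eventually (isOpen_ne.mem_nhds hz0')).mono ?_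
    rintro x ⟨⟨⟨hxM, hxS⟩, hxb⟩, hx0⟩
    have hxU := b2 hxb
    have hker : ∀ v, fderiv ℝ F x v = 0 → inner ℝ x v = 0 := by
      intro v hv
      refine ker_of_milnor (hdH x hxU).differentiableAt hxM hxS v ?_
      rw [(hdH x hxU).fderiv]
      simp [hv]
    have hFx : F x ≠ 0 := fun hFx => hx0 (hT x (b3 hxb) hFx hker)
    exact ⟨⟨milnor_of_ker (hdF x hxU) hker, hnotS x hxU hFx⟩, b1 hxb⟩
  have hzU := b2 hzb
  by_cases hzSF : z ∈ Sing F
  · exact hz0 (hF1 ⟨⟨hzc', hzSF⟩, b1 hzb⟩)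
  have hFz : F z = 0 := by
    by_contra hFz
    apply hzS
    rw [(hdH z hzU).fderiv]
    have s1 : Surjective (fderiv ℝ F z) := by simpa [Sing] using hzSF
    have s2 : Surjective (fderiv ℝ G (F z)) := by
      by_contra hs
      exact hFz (hSingG ⟨hs, hFUV ⟨z, hzU, rfl⟩⟩)
    exact s2.comp s1
  have hzM : z ∈ MilnorSet F := by
    intro hs
    have han : AnalyticAt ℝ (fun y => (F y, ‖y‖ ^ 2)) z := 
      (hF z hzU).prod ((contDiff_norm_sq ℝ (n := ⊤)).contDiffAt).analyticAt
    have hev := han.fderiv.continuousAt.eventually (surj_nhds _ hs)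
    rw [mem_closure_iff_frequently] at hzc'
    obtain ⟨x, hx, hx'⟩ := (hzc'.and_eventually hev).exists
    exact hx.1.1 hx'
  exact hz0 (hT z (b3 hzb) hFz (fun v hv => ker_of_milnor (hdF z hzU) hzM hzSF v hv))
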